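/- arXiv:2405.04728 — 2 statements merged into one kernel-verified Lean document; each statement's English description precedes it below -/
import Mathlib

section
/- Let t ≥ 4 be an integer and let G be a t-tough graph on n ≥ 3 vertices with degree sequence d_1 ≤ d_2 ≤ ⋯ ≤ d_n. If for every integer i with 1 ≤ i < n/2, d_i ≤ i implies d_{n−i+t} ≥ n−i, then G is Hamiltonian. -/
/-- A graph `G` is `t`-tough if `|S| ≥ t · c(G − S)` for every vertex subset `S`
whose removal leaves at least two connected components. -/
def SimpleGraph.Tough {V : Type*} [Fintype V] (t : ℚ) (G : SimpleGraph V) : Prop :=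
  ∀ S : Finset V,
    2 ≤ Nat.card ((G.induce ((↑S : Set V)ᶜ)).ConnectedComponent) →
    t * (Nat.card ((G.induce ((↑S : Set V)ᶜ)).ConnectedComponent) : ℚ) ≤ (S.card : ℚ)

namespace SimpleGraph

section PathEnum

variable {V : Type*} {G : SimpleGraph V} {lo hi : ℕ} {u : ℕ → V}

/-- A Hamiltonian path of `G`, as an enumeration `u lo, …, u (hi - 1)` of the vertices. -/
structure IsPathEnum (G : SimpleGraph V) (lo hi : ℕ) (u : ℕ → V) : Prop where
  injOn : Set.InjOn u (Set.Ico lo hi)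
  surj : ∀ v, ∃ a, lo ≤ a ∧ a < hi ∧ u a = v
  adj : ∀ a, lo ≤ a → a + 1 < hi → G.Adj (u a) (u (a + 1))

/-- The list `u a, …, u (b - 1)`. -/
def segment (u : ℕ → V) (a b : ℕ) : List V := (List.Ico a b).map u

lemma IsPathEnum.isChain_segment (h : G.IsPathEnum lo hi u) {a b : ℕ} (ha : lo ≤ a) (hb : b ≤ hi) :
    (segment u a b).IsChain G.Adj := by
  rw [segment, List.isChain_map]
  refine List.IsChain.imp_of_mem_imp ?_ (List.Ico.isChain_succ a b)
  intro c d hc hd hcd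
  rw [List.Ico.mem] at hc hd
  subst hcd
  exact h.adj c (by omega) (by simp only [Nat.succ_eq_add_one] at hd; omega)

lemma head?_segment {a b : ℕ} (h : a < b) : (segment u a b).head? = some (u a) := by
  simp [segment, List.Ico.eq_cons h]

lemma getLast?_segment {a b : ℕ} (h : a < b) :
    (segment u a b).getLast? = some (u (b - 1)) := by
  obtain ⟨c, rfl⟩ : ∃ c, b = c + 1 := ⟨b - 1, by omega⟩
  simp [segment, List.Ico.succ_top (show a ≤ c by omega)]

lemma segment_append {a b c : ℕ} (hab : a ≤ b) (hbc : b ≤ c) :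
    segment u a b ++ segment u b c = segment u a c := by
  rw [segment, segment, segment, ← List.map_append, List.Ico.append_consecutive hab hbc]

lemma isChain_adj_reverse {l : List V} (h : l.IsChain G.Adj) : l.reverse.IsChain G.Adj := by
  rw [List.isChain_reverse]
  exact h.imp fun _ _ hab => hab.symm

end PathEnum

section HamiltonianPath

variable {V : Type*} [Fintype V] [DecidableEq V] {G : SimpleGraph V} {lo hi : ℕ} {u : ℕ → V}

lemma isHamiltonian_of_list (h3 : 3 ≤ Fintype.card V) (l : List V) (hc : l.IsChain G.Adj)
    (hnd : l.Nodup) (hall : ∀ v, v ∈ l)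
    (hclose : ∀ a ∈ l.getLast?, ∀ b ∈ l.head?, G.Adj a b) : G.IsHamiltonian := by
  have hlen : l.length = Fintype.card V := by
    rw [← List.toFinset_card_of_nodup hnd, ← Finset.card_univ]
    congr 1
    ext v
    simp [hall]
  have hne : l ≠ [] := by
    rintro rfl
    simp at hlen
    omega
  intro _
  let p := Walk.ofSupport l hne hc
  have hp : p.IsPath := by
    rw [Walk.isPath_def, Walk.support_ofSupport]
    exact hnd
  have hadj : G.Adj (l.getLast hne) (l.head hne) :=
    hclose _ (List.getLast?_eq_some_getLast hne) _ (List.head?_eq_some_head hne)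
  have hplen : p.length = l.length - 1 := Walk.length_ofSupport hne hc
  refine ⟨_, Walk.cons hadj p, ?_⟩
  rw [Walk.isHamiltonianCycle_iff_isCycle_and_length_eq, Walk.cons_isCycle_iff]
  refine ⟨⟨hp, fun h => ?_⟩, ?_⟩
  · have := hp.length_eq_one_of_mem_edges (Sym2.eq_swap ▸ h)
    omega
  · rw [Walk.length_cons]
    omega

lemma exists_isHamiltonian_path_of_snd {x y : V} (p : (G ⊔ edge x y).Walk x x)
    (hp : p.IsHamiltonianCycle) (hsnd : p.snd = y) : ∃ q : G.Walk x y, q.IsHamiltonian := by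
  cases p with
  | nil => exact absurd hp.isCycle (by simp)
  | @cons _ w _ h q =>
    rw [Walk.snd_cons] at hsnd
    subst hsnd
    have hc := (Walk.cons_isCycle_iff q h).1 hp.isCycle
    have hq : q.IsHamiltonian := by
      rw [Walk.isHamiltonian_iff_isPath_and_length_eq]
      have := hp.length_eq
      rw [Walk.length_cons] at this
      exact ⟨hc.1, by omega⟩
    have hG : ∀ e ∈ q.edges, e ∈ G.edgeSet := by
      intro e he
      have h1 := q.edges_subset_edgeSet he
      rw [edgeSet_sup] at h1
      rcases h1 with h1 | h1
      · exact h1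
      · have h2 : e = s(x, w) := edgeSet_edge_subset h1
        exact absurd (h2 ▸ he) hc.2
    refine ⟨(q.transfer G hG).reverse, fun a => ?_⟩
    rw [Walk.support_reverse, List.count_reverse, Walk.support_transfer]
    exact hq a

lemma exists_isHamiltonian_path_of_sup_edge (h3 : 3 ≤ Fintype.card V) {x y : V}
    (hG : ¬ G.IsHamiltonian) (hH : (G ⊔ edge x y).IsHamiltonian) :
    ∃ q : G.Walk x y, q.IsHamiltonian := by
  have : Nontrivial V := Fintype.one_lt_card_iff_nontrivial.1 (by omega)
  obtain ⟨p, hp⟩ := hH.exists_isHamiltonianCycle x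
  by_cases he : s(x, y) ∈ p.edges
  · by_cases hs : p.snd = y
    · exact exists_isHamiltonian_path_of_snd p hp hs
    · refine exists_isHamiltonian_path_of_snd p.reverse ?_ ?_
      · rw [Walk.isHamiltonianCycle_iff_isCycle_and_length_eq, Walk.isCycle_reverse,
          Walk.length_reverse]
        exact ⟨hp.isCycle, hp.length_eq⟩
      · rw [Walk.snd_reverse]
        cases p with
        | nil => simp at he
        | @cons _ w _ h q =>
          have hc := (Walk.cons_isCycle_iff q h).1 hp.isCycle
          rw [Walk.snd_cons] at hs
          have hq : s(x, y) ∈ q.edges := by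
            rw [Walk.edges_cons, List.mem_cons] at he
            rcases he with he | he
            · rw [Sym2.congr_right] at he
              exact absurd he.symm hs
            · exact he
          have hnil : ¬ q.Nil := by
            intro hn
            rw [← Walk.length_eq_zero_iff] at hn
            cases q <;> simp at hn hq
          rw [Walk.penultimate_cons_of_not_nil _ _ hnil]
          exact (hc.1.eq_penultimate_of_mem_edges hq).symm
  · refine absurd ?_ hG
    intro _
    have hE : ∀ e ∈ p.edges, e ∈ G.edgeSet := by
      intro e hep
      have h1 := p.edges_subset_edgeSet hep
      rw [edgeSet_sup] at h1
      rcases h1 with h1 | h1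
      · exact h1
      · have h2 : e = s(x, y) := edgeSet_edge_subset h1
        exact absurd (h2 ▸ hep) he
    refine ⟨x, p.transfer G hE, ?_⟩
    rw [Walk.isHamiltonianCycle_iff_isCycle_and_length_eq, Walk.length_transfer]
    exact ⟨hp.isCycle.transfer hE, hp.length_eq⟩

lemma Walk.IsHamiltonian.exists_isPathEnum {x y : V} {q : G.Walk x y} (hq : q.IsHamiltonian)
    (lo : ℕ) : ∃ u, G.IsPathEnum lo (lo + Fintype.card V) u ∧ u lo = x ∧
      u (lo + Fintype.card V - 1) = y := by
  have hlen := hq.length_eq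
  have hpos : 0 < Fintype.card V := Fintype.card_pos_iff.2 ⟨x⟩
  refine ⟨fun a => q.getVert (a - lo), ⟨?_, ?_, ?_⟩, by simp, ?_⟩
  · intro a ha b hb hab
    simp only [Set.mem_Ico] at ha hb
    have := hq.isPath.getVert_injOn (x₁ := a - lo) (x₂ := b - lo)
      (by simp only [Set.mem_ofPred_eq]; omega) (by simp only [Set.mem_ofPred_eq]; omega) hab
    omega
  · intro v
    obtain ⟨k, hk, hkl⟩ := Walk.mem_support_iff_exists_getVert.1 (hq.mem_support v)
    exact ⟨lo + k, by omega, by omega, by simpa using hk⟩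
  · intro a ha hlt
    have := q.adj_getVert_succ (i := a - lo) (by omega)
    rwa [show a - lo + 1 = a + 1 - lo by omega] at this
  · have : lo + Fintype.card V - 1 - lo = q.length := by omega
    simp only [this, Walk.getVert_length]

lemma IsPathEnum.isHamiltonian_of_perm (h : G.IsPathEnum lo hi u) (h3 : 3 ≤ Fintype.card V)
    (l : List V) (hperm : l.Perm (segment u lo hi)) (hc : l.IsChain G.Adj)
    (hclose : ∀ a ∈ l.getLast?, ∀ b ∈ l.head?, G.Adj a b) : G.IsHamiltonian := by
  refine isHamiltonian_of_list h3 l hc ?_ ?_ hclose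
  · rw [hperm.nodup_iff]
    refine List.Nodup.map_on ?_ (List.Ico.nodup lo hi)
    intro a ha b hb hab
    rw [List.Ico.mem] at ha hb
    exact h.injOn ha hb hab
  · intro v
    rw [hperm.mem_iff]
    obtain ⟨a, ha, hb, rfl⟩ := h.surj v
    exact List.mem_map_of_mem (List.Ico.mem.2 ⟨ha, hb⟩)

lemma IsPathEnum.isHamiltonian_of_rotation (h : G.IsPathEnum lo hi u) (h3 : 3 ≤ Fintype.card V)
    {a : ℕ} (ha : lo < a) (hb : a < hi)
    (h1 : G.Adj (u (a - 1)) (u (hi - 1))) (h2 : G.Adj (u a) (u lo)) : G.IsHamiltonian := by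
  have c1 := h.isChain_segment (a := lo) (b := a) le_rfl hb.le
  have c2 := h.isChain_segment (a := a) (b := hi) ha.le le_rfl
  refine h.isHamiltonian_of_perm h3 (segment u lo a ++ (segment u a hi).reverse) ?_ ?_ ?_
  · rw [← segment_append ha.le hb.le]
    exact (List.reverse_perm _).append_left _
  · rw [List.isChain_append]
    refine ⟨c1, isChain_adj_reverse c2, ?_⟩
    simpa [head?_segment, getLast?_segment, ha, hb] using h1
  · simpa [head?_segment, getLast?_segment, ha, hb, List.getLast?_append, List.head?_append]
      using h2

lemma IsPathEnum.isHamiltonian_of_crossing (h : G.IsPathEnum lo hi u) (h3 : 3 ≤ Fintype.card V)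
    {a b : ℕ} (ha : lo < a) (hab : a < b) (hb : b < hi)
    (h1 : G.Adj (u (a - 1)) (u b)) (h2 : G.Adj (u (hi - 1)) (u (b - 1)))
    (h0 : G.Adj (u a) (u lo)) : G.IsHamiltonian := by
  have c1 := h.isChain_segment (a := lo) (b := a) le_rfl (by omega)
  have c2 := h.isChain_segment (a := a) (b := b) ha.le hb.le
  have c3 := h.isChain_segment (a := b) (b := hi) (by omega) le_rfl
  refine h.isHamiltonian_of_perm h3
    (segment u lo a ++ (segment u b hi ++ (segment u a b).reverse)) ?_ ?_ ?_
  · rw [← segment_append ha.le (hab.trans hb).le, ← segment_append hab.le hb.le]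
    refine List.Perm.append_left _ (List.perm_append_comm.trans ?_)
    exact (List.reverse_perm _).append_right _
  · rw [List.isChain_append, List.isChain_append]
    refine ⟨c1, ⟨c3, isChain_adj_reverse c2, ?_⟩, ?_⟩
    · simpa [head?_segment, getLast?_segment, hab, hb] using h2
    · simpa [head?_segment, getLast?_segment, ha, hb, List.head?_append] using h1
  · simpa [head?_segment, getLast?_segment, ha, hab, hb, List.getLast?_append, List.head?_append]
      using h0

lemma IsPathEnum.isHamiltonian_of_inner_reversal (h : G.IsPathEnum lo hi u)
    (h3 : 3 ≤ Fintype.card V) {a b : ℕ} (ha : lo < a) (hab : a < b) (hb : b < hi)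
    (h1 : G.Adj (u (a - 1)) (u (b - 1))) (h2 : G.Adj (u a) (u (hi - 1)))
    (h0 : G.Adj (u b) (u lo)) : G.IsHamiltonian := by
  have c1 := h.isChain_segment (a := lo) (b := a) le_rfl (by omega)
  have c2 := h.isChain_segment (a := a) (b := b) ha.le hb.le
  have c3 := h.isChain_segment (a := b) (b := hi) (by omega) le_rfl
  refine h.isHamiltonian_of_perm h3
    (segment u lo a ++ ((segment u a b).reverse ++ (segment u b hi).reverse)) ?_ ?_ ?_
  · rw [← segment_append ha.le (hab.trans hb).le, ← segment_append hab.le hb.le]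
    exact List.Perm.append_left _ ((List.reverse_perm _).append (List.reverse_perm _))
  · rw [List.isChain_append, List.isChain_append]
    refine ⟨c1, ⟨isChain_adj_reverse c2, isChain_adj_reverse c3, ?_⟩, ?_⟩
    · simpa [head?_segment, getLast?_segment, hab, hb] using h2
    · simpa [head?_segment, getLast?_segment, ha, hab, hb, List.head?_append] using h1
  · simpa [head?_segment, getLast?_segment, ha, hab, hb, List.getLast?_append, List.head?_append]
      using h0

lemma IsPathEnum.isHamiltonian_of_outer_reversal (h : G.IsPathEnum lo hi u)
    (h3 : 3 ≤ Fintype.card V) {a b : ℕ} (ha : lo < a) (hab : a < b) (hb : b < hi)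
    (h1 : G.Adj (u (a - 1)) (u (hi - 1))) (h2 : G.Adj (u b) (u a))
    (h0 : G.Adj (u (b - 1)) (u lo)) : G.IsHamiltonian := by
  have c1 := h.isChain_segment (a := lo) (b := a) le_rfl (by omega)
  have c2 := h.isChain_segment (a := a) (b := b) ha.le hb.le
  have c3 := h.isChain_segment (a := b) (b := hi) (by omega) le_rfl
  refine h.isHamiltonian_of_perm h3
    (segment u lo a ++ ((segment u b hi).reverse ++ segment u a b)) ?_ ?_ ?_
  · rw [← segment_append ha.le (hab.trans hb).le, ← segment_append hab.le hb.le]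
    refine List.Perm.append_left _ (List.perm_append_comm.trans ?_)
    exact (List.reverse_perm _).append_left _
  · rw [List.isChain_append, List.isChain_append]
    refine ⟨c1, ⟨isChain_adj_reverse c3, c2, ?_⟩, ?_⟩
    · simpa [head?_segment, getLast?_segment, hab, hb] using h2
    · simpa [head?_segment, getLast?_segment, ha, hab, hb, List.head?_append] using h1
  · simpa [head?_segment, getLast?_segment, ha, hab, hb, List.getLast?_append, List.head?_append]
      using h0

end HamiltonianPath

section Toughness

variable {V : Type*}

/-- A vertex set `S` whose removal leaves a graph in which `|R| ≥ 2` vertices are pairwise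
separated, as witnessed by a function `f` constant on connected components, has size at least
`t * |R|`. -/
def SeparatorBound (t : ℕ) (G : SimpleGraph V) : Prop :=
  ∀ (S R : Finset V) (f : V → V), (∀ r ∈ R, r ∉ S ∧ f r = r) →
    (∀ a b, a ∉ S → b ∉ S → G.Adj a b → f a = f b) → 2 ≤ R.card → t * R.card ≤ S.card

lemma SeparatorBound.mono {t : ℕ} {G H : SimpleGraph V} (h : SeparatorBound t G) (hGH : G ≤ H) :
    SeparatorBound t H :=
  fun S R f hR hf => h S R f hR fun a b ha hb hab => hf a b ha hb (hGH hab)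

lemma Tough.separatorBound [Fintype V] {t : ℕ} {G : SimpleGraph V} (h : Tough (t : ℚ) G) :
    SeparatorBound t G := by
  classical
  intro S R f hR hf h2
  let C := (G.induce ((↑S : Set V)ᶜ)).ConnectedComponent
  have key : ∀ x y, (G.induce ((↑S : Set V)ᶜ)).Reachable x y → f x = f y := by
    rintro x y ⟨p⟩
    induction p with
    | nil => rfl
    | @cons a b c hab p ih =>
      exact (hf a b (mt Finset.mem_coe.2 a.2) (mt Finset.mem_coe.2 b.2) hab).trans ih
  let φ : R → C := fun r =>
    (G.induce ((↑S : Set V)ᶜ)).connectedComponentMk ⟨r, by simpa using (hR r r.2).1⟩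
  have hφ : Function.Injective φ := by
    intro r s hrs
    have := key _ _ (ConnectedComponent.exact hrs)
    simp only [(hR r r.2).2, (hR s s.2).2] at this
    exact Subtype.ext this
  have hle : R.card ≤ Nat.card C := by
    have := Nat.card_le_card_of_injective φ hφ
    simpa using this
  have h1 : t * Nat.card C ≤ S.card := by exact_mod_cast h S (h2.trans hle)
  exact (Nat.mul_le_mul_left t hle).trans h1

variable [Fintype V] [DecidableEq V] {t : ℕ} {G : SimpleGraph V}

lemma SeparatorBound.le_card_of_isIndepSet (h : SeparatorBound t G) {R : Finset V}
    (hR : ∀ a ∈ R, ∀ b ∈ R, ¬ G.Adj a b) (h2 : 2 ≤ R.card) :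
    (t + 1) * R.card ≤ Fintype.card V := by
  have := h Rᶜ R id (by simp) (fun a b ha hb hab => by
    rw [Finset.mem_compl, not_not] at ha hb
    exact absurd hab (hR a ha b hb)) h2
  have h3 := Finset.card_add_card_compl R
  linarith

variable [DecidableRel G.Adj]

lemma SeparatorBound.le_card_neighbors (h : SeparatorBound t G) {I : Finset V} {y : V}
    (hI : ∀ a ∈ I, ∀ b ∈ I, ¬ G.Adj a b) (hne : I.Nonempty) (hy : y ∉ I)
    (hyI : ∀ a ∈ I, ¬ G.Adj a y) :
    t * (I.card + 1) ≤ (Finset.univ.filter fun v => ∃ a ∈ I, G.Adj a v).card := by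
  have hpos := hne.card_pos
  have := h (Finset.univ.filter fun v => ∃ a ∈ I, G.Adj a v) (insert y I)
    (fun v => if v ∈ I then v else y) ?_ ?_ ?_
  · rwa [Finset.card_insert_of_notMem hy] at this
  · intro r hr
    rw [Finset.mem_insert] at hr
    rcases hr with rfl | hr
    · simpa [hy] using hyI
    · simpa [hr] using fun a ha => hI a ha r hr
  · intro a b ha hb hab
    simp only [Finset.mem_filter, Finset.mem_univ, true_and, not_exists, not_and] at ha hb
    have ha' : a ∉ I := fun h' => hb a h' hab
    have hb' : b ∉ I := fun h' => ha b h' hab.symm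
    simp [ha', hb']
  · rw [Finset.card_insert_of_notMem hy]
    omega

lemma SeparatorBound.two_mul_le_degree (h : SeparatorBound t G) {x y : V} (hxy : x ≠ y)
    (hadj : ¬ G.Adj x y) : 2 * t ≤ G.degree x := by
  have := h.le_card_neighbors (I := {x}) (y := y) (by simp) (by simp) (by simpa using hxy.symm)
    (by simpa using hadj)
  rw [← card_neighborFinset_eq_degree, neighborFinset_eq_filter]
  simp only [Finset.card_singleton, Finset.mem_singleton, exists_eq_left] at this
  omega

end Toughness

section Labelling

/-- Two disjoint predicates on `ℕ`, the first one holding on `{0, 1}` and the second one on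
`{n + 1, n + 2, …}`. -/
structure IsLabelling (n : ℕ) (X Y : ℕ → Prop) : Prop where
  not_and : ∀ a, ¬ (X a ∧ Y a)
  left : ∀ a, a ≤ 1 → X a
  right : ∀ a, n + 1 ≤ a → Y a

variable {n : ℕ} {X Y : ℕ → Prop}

lemma IsLabelling.two_le (h : IsLabelling n X Y) {a : ℕ} (ha : ¬ X a) : 2 ≤ a := by
  by_contra hlt
  exact ha (h.left a (by omega))

lemma IsLabelling.le_of_not (h : IsLabelling n X Y) {a : ℕ} (ha : ¬ Y a) : a ≤ n := by
  by_contra hlt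
  exact ha (h.right a (by omega))

variable (n X Y) [DecidablePred X] [DecidablePred Y]

/-- The positions at which neither label is present. -/
def blanks : Finset ℕ := (Finset.Icc 2 (n + 1)).filter fun a => ¬ X a ∧ ¬ Y a

/-- The positions at which the label changes from `Y` to `X`. -/
def descents : Finset ℕ := (Finset.Icc 2 (n + 1)).filter fun a => Y (a - 1) ∧ X a

/-- The positions at which the label changes from `X` to `Y`. -/
def ascents : Finset ℕ := (Finset.Icc 2 (n + 1)).filter fun a => X (a - 1) ∧ Y a

variable {n X Y}

lemma IsLabelling.card_ascents_le (h : IsLabelling n X Y) :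
    (ascents n X Y).card ≤ (descents n X Y).card + (blanks n X Y).card + 1 := by
  have key : ∀ m, 1 ≤ m →
      ((Finset.Icc 2 m).filter fun a => X (a - 1) ∧ Y a).card ≤
        ((Finset.Icc 2 m).filter fun a => Y (a - 1) ∧ X a).card +
        ((Finset.Icc 2 m).filter fun a => ¬ X a ∧ ¬ Y a).card + if Y m then 1 else 0 := by
    intro m hm
    induction m, hm using Nat.le_induction with
    | base => simp
    | succ m hm ih =>
      simp only [Finset.card_filter] at ih ⊢
      rw [Finset.sum_Icc_succ_top (by omega), Finset.sum_Icc_succ_top (by omega),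
        Finset.sum_Icc_succ_top (by omega)]
      have h1 := h.not_and m
      have h2 := h.not_and (m + 1)
      simp only [Nat.add_sub_cancel]
      by_cases a : X m <;> by_cases b : Y m <;> by_cases c : X (m + 1) <;>
        by_cases d : Y (m + 1) <;> simp only [a, b, c, d] at ih h1 h2 ⊢ <;> simp at ih h1 h2 ⊢ <;>
        omega
  refine (key (n + 1) (by omega)).trans ?_
  rw [descents, blanks]
  split_ifs <;> omega

lemma mem_blanks {a : ℕ} : a ∈ blanks n X Y ↔ (2 ≤ a ∧ a ≤ n + 1) ∧ ¬ X a ∧ ¬ Y a := by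
  simp [blanks]

lemma mem_descents {a : ℕ} : a ∈ descents n X Y ↔ (2 ≤ a ∧ a ≤ n + 1) ∧ Y (a - 1) ∧ X a := by
  simp [descents]

lemma mem_ascents {a : ℕ} : a ∈ ascents n X Y ↔ (2 ≤ a ∧ a ≤ n + 1) ∧ X (a - 1) ∧ Y a := by
  simp [ascents]

lemma IsLabelling.mem_blanks_iff (h : IsLabelling n X Y) {a : ℕ} :
    a ∈ blanks n X Y ↔ ¬ X a ∧ ¬ Y a := by
  rw [mem_blanks]
  exact ⟨fun h => h.2, fun h' => ⟨⟨h.two_le h'.1, (h.le_of_not h'.2).trans (by omega)⟩, h'⟩⟩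

lemma IsLabelling.mem_descents_iff (h : IsLabelling n X Y) {a : ℕ} :
    a ∈ descents n X Y ↔ Y (a - 1) ∧ X a := by
  rw [mem_descents]
  refine ⟨fun h => h.2, fun h' => ⟨⟨?_, ?_⟩, h'⟩⟩
  · have := h.two_le (fun hX => h.not_and _ ⟨hX, h'.1⟩)
    omega
  · exact (h.le_of_not (fun hY => h.not_and _ ⟨h'.2, hY⟩)).trans (by omega)

variable (X Y) in
/-- The positions kept when no descent occurs. -/
def IsWeaklyKept (a : ℕ) : Prop := X a ∨ (Y (a - 1) ∧ Y a ∧ Y (a + 1))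

variable (X Y) in
/-- The positions kept when separating the graph by means of the descents. -/
def IsKept (a : ℕ) : Prop :=
  (Y (a - 1) ∧ X a) ∨ (X (a - 2) ∧ X (a - 1) ∧ X a) ∨ (Y (a - 1) ∧ Y a ∧ Y (a + 1))

lemma IsLabelling.card_not_isWeaklyKept_le (h : IsLabelling n X Y) (h0 : descents n X Y = ∅)
    [DecidablePred (IsWeaklyKept X Y)] :
    ((Finset.Icc 2 (n + 1)).filter fun a => ¬ IsWeaklyKept X Y a).card ≤
      4 * (blanks n X Y).card + 1 := by
  have hsub : ((Finset.Icc 2 (n + 1)).filter fun a => ¬ IsWeaklyKept X Y a) ⊆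
      ascents n X Y ∪ blanks n X Y ∪ (blanks n X Y).image (· + 1) ∪
        (blanks n X Y).image (· - 1) := by
    intro a ha
    rw [Finset.mem_filter, Finset.mem_Icc, IsWeaklyKept] at ha
    simp only [Finset.mem_union, Finset.mem_image, mem_ascents]
    obtain ⟨hI, hk⟩ := ha
    have hXa : ¬ X a := fun hX => hk (Or.inl hX)
    by_cases hYa : Y a
    · by_cases hX1 : X (a - 1)
      · exact Or.inl (Or.inl (Or.inl ⟨hI, hX1, hYa⟩))
      by_cases hY1 : Y (a - 1)
      · have hY2 : ¬ Y (a + 1) := fun hY => hk (Or.inr ⟨hY1, hYa, hY⟩)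
        have hX2 : ¬ X (a + 1) := fun hX => by
          have : a + 1 ∈ descents n X Y := h.mem_descents_iff.2 ⟨by simpa using hYa, hX⟩
          simp [h0] at this
        exact Or.inr ⟨a + 1, h.mem_blanks_iff.2 ⟨hX2, hY2⟩, by omega⟩
      · exact Or.inl (Or.inr ⟨a - 1, h.mem_blanks_iff.2 ⟨hX1, hY1⟩, by omega⟩)
    · exact Or.inl (Or.inl (Or.inr (h.mem_blanks_iff.2 ⟨hXa, hYa⟩)))
  have h1 := Finset.card_le_card hsub
  have h2 := h.card_ascents_le
  rw [h0, Finset.card_empty] at h2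
  have h3 := Finset.card_image_le (s := blanks n X Y) (f := (· + 1))
  have h4 := Finset.card_image_le (s := blanks n X Y) (f := (· - 1))
  refine h1.trans ((Finset.card_union_le _ _).trans ?_)
  have h5 := Finset.card_union_le (ascents n X Y ∪ blanks n X Y) ((blanks n X Y).image (· + 1))
  have h6 := Finset.card_union_le (ascents n X Y) (blanks n X Y)
  omega

lemma IsLabelling.card_not_isKept_le (h : IsLabelling n X Y) [DecidablePred (IsKept X Y)] :
    ((Finset.Icc 2 (n + 1)).filter fun a => ¬ IsKept X Y a).card ≤
      3 * (descents n X Y).card + 5 * (blanks n X Y).card + 1 := by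
  have hsub : ((Finset.Icc 2 (n + 1)).filter fun a => ¬ IsKept X Y a) ⊆
      (ascents n X Y ∪ (descents n X Y).image (· + 1) ∪ (descents n X Y).image (· - 1)) ∪
      (blanks n X Y ∪ (blanks n X Y).image (· + 1) ∪ (blanks n X Y).image (· + 2) ∪
        (blanks n X Y).image (· - 1)) := by
    intro a ha
    rw [Finset.mem_filter, Finset.mem_Icc, IsKept, not_or, not_or] at ha
    simp only [Finset.mem_union, Finset.mem_image, mem_ascents]
    obtain ⟨hI, hk1, hk2, hk3⟩ := ha
    by_cases hXa : X a
    · by_cases hX1 : X (a - 1)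
      · have hX2 : ¬ X (a - 2) := fun hX => hk2 ⟨hX, hX1, hXa⟩
        have hle := h.two_le hX2
        by_cases hY2 : Y (a - 2)
        · exact Or.inl (Or.inl (Or.inr ⟨a - 1, h.mem_descents_iff.2
            ⟨by rwa [show a - 1 - 1 = a - 2 by omega], hX1⟩, by omega⟩))
        · exact Or.inr (Or.inl (Or.inr ⟨a - 2, h.mem_blanks_iff.2 ⟨hX2, hY2⟩, by omega⟩))
      · have hY1 : ¬ Y (a - 1) := fun hY => hk1 ⟨hY, hXa⟩
        exact Or.inr (Or.inl (Or.inl (Or.inr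
          ⟨a - 1, h.mem_blanks_iff.2 ⟨hX1, hY1⟩, by omega⟩)))
    by_cases hYa : Y a
    · by_cases hX1 : X (a - 1)
      · exact Or.inl (Or.inl (Or.inl ⟨hI, hX1, hYa⟩))
      by_cases hY1 : Y (a - 1)
      · have hY2 : ¬ Y (a + 1) := fun hY => hk3 ⟨hY1, hYa, hY⟩
        by_cases hX2 : X (a + 1)
        · exact Or.inl (Or.inr ⟨a + 1, h.mem_descents_iff.2 ⟨by simpa using hYa, hX2⟩, by omega⟩)
        · exact Or.inr (Or.inr ⟨a + 1, h.mem_blanks_iff.2 ⟨hX2, hY2⟩, by omega⟩)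
      · exact Or.inr (Or.inl (Or.inl (Or.inr
          ⟨a - 1, h.mem_blanks_iff.2 ⟨hX1, hY1⟩, by omega⟩)))
    · exact Or.inr (Or.inl (Or.inl (Or.inl (h.mem_blanks_iff.2 ⟨hXa, hYa⟩))))
  have h1 := Finset.card_le_card hsub
  have h2 := h.card_ascents_le
  have h3 := Finset.card_image_le (s := blanks n X Y) (f := (· + 1))
  have h4 := Finset.card_image_le (s := blanks n X Y) (f := (· + 2))
  have h5 := Finset.card_image_le (s := blanks n X Y) (f := (· - 1))
  have h6 := Finset.card_image_le (s := descents n X Y) (f := (· + 1))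
  have h7 := Finset.card_image_le (s := descents n X Y) (f := (· - 1))
  refine h1.trans ((Finset.card_union_le _ _).trans ?_)
  refine (Nat.add_le_add ((Finset.card_union_le _ _).trans
    (Nat.add_le_add_right (Finset.card_union_le _ _) _)) ((Finset.card_union_le _ _).trans
    (Nat.add_le_add_right ((Finset.card_union_le _ _).trans
    (Nat.add_le_add_right (Finset.card_union_le _ _) _)) _))).trans ?_
  omega

end Labelling

section PathLabels

variable {V : Type*}

/-- The edge `u a — u (a + 1)` of a path starting at `u 2` is labelled when `u (a + 1)` is a
neighbor of `u 2`; the labels at `0` and `1` are a convention. -/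
def LeftLabel (G : SimpleGraph V) (n : ℕ) (u : ℕ → V) (a : ℕ) : Prop :=
  a ≤ 1 ∨ (a ≤ n ∧ G.Adj (u 2) (u (a + 1)))

/-- The edge `u a — u (a + 1)` of a path ending at `u (n + 1)` is labelled when `u a` is a
neighbor of `u (n + 1)`; the labels from `n + 1` on are a convention. -/
def RightLabel (G : SimpleGraph V) (n : ℕ) (u : ℕ → V) (a : ℕ) : Prop :=
  n + 1 ≤ a ∨ (2 ≤ a ∧ G.Adj (u (n + 1)) (u a))

open scoped Classical in
/-- The class of a kept position: descents are alone in their class, and there are two further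
classes, represented by `2` and `n + 1`. -/
noncomputable def keptClass (X Y : ℕ → Prop) (n a : ℕ) : ℕ :=
  if Y (a - 1) ∧ X a then a else if X a then 2 else n + 1

variable {G : SimpleGraph V} {n t : ℕ} {u : ℕ → V}

lemma IsPathEnum.ne (h : G.IsPathEnum 2 (n + 2) u) {a b : ℕ} (ha : 2 ≤ a) (hab : a < b)
    (hb : b ≤ n + 1) : u a ≠ u b := by
  intro he
  have := h.injOn ⟨ha, by omega⟩ ⟨by omega, by omega⟩ he
  omega

variable [Fintype V]

lemma IsPathEnum.card_eq (h : G.IsPathEnum 2 (n + 2) u) (P : V → Prop) [DecidablePred P] :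
    (Finset.univ.filter P).card = ((Finset.Icc 2 (n + 1)).filter fun a => P (u a)).card := by
  symm
  refine Finset.card_bij (fun a _ => u a) ?_ ?_ ?_
  · intro a ha
    simpa using (Finset.mem_filter.1 ha).2
  · intro a ha b hb hab
    simp only [Finset.mem_filter, Finset.mem_Icc] at ha hb
    exact h.injOn ⟨ha.1.1, by omega⟩ ⟨hb.1.1, by omega⟩ hab
  · intro v hv
    obtain ⟨a, h1, h2, rfl⟩ := h.surj v
    refine ⟨a, ?_, rfl⟩
    simp only [Finset.mem_filter, Finset.mem_Icc, Finset.mem_univ, true_and] at hv ⊢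
    exact ⟨by omega, hv⟩

variable [DecidableEq V]

lemma IsPathEnum.separatorBound (h : G.IsPathEnum 2 (n + 2) u) (hG : SeparatorBound t G)
    {P : ℕ → Prop} [DecidablePred P] {c : ℕ → ℕ} {F : Finset ℕ}
    (hF : ∀ r ∈ F, (2 ≤ r ∧ r ≤ n + 1) ∧ P r ∧ c r = r) (h2 : 2 ≤ F.card)
    (hadj : ∀ a b, 2 ≤ a → a < b → b ≤ n + 1 → P a → P b → c a ≠ c b → ¬ G.Adj (u a) (u b)) :
    t * F.card ≤ ((Finset.Icc 2 (n + 1)).filter fun a => ¬ P a).card := by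
  choose idx hlo hhi hidx using h.surj
  have hinv : ∀ a, 2 ≤ a → a ≤ n + 1 → idx (u a) = a := fun a h1 h2 =>
    h.injOn ⟨hlo _, hhi _⟩ ⟨h1, by omega⟩ (hidx _)
  have hinj : Set.InjOn u F := fun a ha b hb hab =>
    h.injOn ⟨(hF a ha).1.1, Nat.lt_succ_of_le (hF a ha).1.2⟩
      ⟨(hF b hb).1.1, Nat.lt_succ_of_le (hF b hb).1.2⟩ hab
  have := hG (Finset.univ.filter fun v => ¬ P (idx v)) (F.image u) (fun v => u (c (idx v)))
    ?_ ?_ ?_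
  · rw [Finset.card_image_of_injOn hinj, h.card_eq] at this
    refine this.trans (Finset.card_le_card fun a ha => ?_)
    rw [Finset.mem_filter, Finset.mem_Icc] at ha ⊢
    rw [hinv a ha.1.1 ha.1.2] at ha
    exact ha
  · intro v hv
    obtain ⟨r, hr, rfl⟩ := Finset.mem_image.1 hv
    obtain ⟨hI, hP, hc⟩ := hF r hr
    simp [hinv r hI.1 hI.2, hP, hc]
  · intro v w hv hw hvw
    simp only [Finset.mem_filter, Finset.mem_univ, true_and, not_not] at hv hw
    by_contra hne
    have hc : c (idx v) ≠ c (idx w) := fun h' => hne (by simp only [h'])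
    rcases lt_trichotomy (idx v) (idx w) with hlt | heq | hlt
    · refine hadj _ _ (hlo v) hlt (Nat.le_of_lt_succ (hhi w)) hv hw hc ?_
      rwa [hidx, hidx]
    · exact hc (by rw [heq])
    · refine hadj _ _ (hlo w) hlt (Nat.le_of_lt_succ (hhi v)) hw hv hc.symm ?_
      rw [hidx, hidx]
      exact hvw.symm
  · rwa [Finset.card_image_of_injOn hinj]

/-- A Hamiltonian path `u 2, …, u (n + 1)` with nonadjacent ends in a non-Hamiltonian graph. -/
structure IsCriticalPath (G : SimpleGraph V) (n : ℕ) (u : ℕ → V) : Prop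
    extends G.IsPathEnum 2 (n + 2) u where
  card_eq_self : Fintype.card V = n
  three_le : 3 ≤ n
  not_isHamiltonian : ¬ G.IsHamiltonian
  not_adj : ¬ G.Adj (u 2) (u (n + 1))

namespace IsCriticalPath

lemma isLabelling (h : G.IsCriticalPath n u)
    : IsLabelling n (G.LeftLabel n u) (G.RightLabel n u) where
  not_and := by
    have h3 := h.three_le
    rintro a ⟨hX | ⟨hX, hX'⟩, hY | ⟨hY, hY'⟩⟩
    · omega
    · omega
    · omega
    · exact h.not_isHamiltonian (h.isHamiltonian_of_rotation (h.card_eq_self ▸ h3) (a := a + 1)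
        (by omega) (by omega) hY'.symm hX'.symm)
  left := fun a ha => Or.inl ha
  right := fun a ha => Or.inl ha

lemma not_left_right (h : G.IsCriticalPath n u)
    {a b : ℕ} (ha : 2 ≤ a) (hab : a < b) (hb : b ≤ n + 1)
    (hadj : G.Adj (u a) (u b)) : ¬ (G.LeftLabel n u a ∧ G.RightLabel n u (b - 1)) := by
  rintro ⟨hX, hY⟩
  rcases Nat.eq_or_lt_of_le (Nat.succ_le_of_lt hab) with rfl | hlt
  · exact h.isLabelling.not_and _ ⟨hX, hY⟩
  have hlt' : a + 1 < b := hlt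
  have h3 := h.three_le
  rcases hX with hX | ⟨hX, hX'⟩
  · omega
  rcases hY with hY | ⟨hY, hY'⟩
  · omega
  exact h.not_isHamiltonian (h.isHamiltonian_of_crossing (h.card_eq_self ▸ h3) (a := a + 1)
    (by omega) hlt' (by omega) hadj hY' hX'.symm)

lemma not_right_left (h : G.IsCriticalPath n u) {a b : ℕ} (ha : 2 ≤ a) (hab : a < b)
    (hadj : G.Adj (u a) (u b)) : ¬ (G.RightLabel n u (a + 1) ∧ G.LeftLabel n u b) := by
  rintro ⟨hY, hX⟩
  have h3 := h.three_le
  rcases hX with hX | ⟨hX, hX'⟩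
  · omega
  rcases hY with hY | ⟨hY, hY'⟩
  · omega
  exact h.not_isHamiltonian (h.isHamiltonian_of_inner_reversal (h.card_eq_self ▸ h3) (a := a + 1)
    (b := b + 1) (by omega) (by omega) (by omega) hadj hY'.symm hX'.symm)

lemma not_right_left_outer (h : G.IsCriticalPath n u) {a b : ℕ} (hab : a < b) (hb : b ≤ n + 1)
    (hadj : G.Adj (u a) (u b)) : ¬ (G.RightLabel n u (a - 1) ∧ G.LeftLabel n u (b - 2)) := by
  rintro ⟨hY, hX⟩
  have h3 := h.three_le
  rcases hY with hY | ⟨hY, hY'⟩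
  · omega
  rcases hX with hX | ⟨hX, hX'⟩
  · omega
  rw [show b - 2 + 1 = b - 1 by omega] at hX'
  exact h.not_isHamiltonian (h.isHamiltonian_of_outer_reversal (h.card_eq_self ▸ h3) (a := a)
    (b := b) (by omega) (by omega) (by omega) hY'.symm hadj.symm hX'.symm)

lemma leftLabel_two (h : G.IsCriticalPath n u) : G.LeftLabel n u 2 :=
  Or.inr ⟨by have := h.three_le; omega, h.adj 2 le_rfl (by have := h.three_le; omega)⟩

lemma rightLabel_self (h : G.IsCriticalPath n u) : G.RightLabel n u n :=
  Or.inr ⟨by have := h.three_le; omega,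
    (h.adj n (by have := h.three_le; omega) (by omega)).symm⟩

lemma not_adj_of_isWeaklyKept (h : G.IsCriticalPath n u)
    {a b : ℕ} (ha : 2 ≤ a) (hab : a < b) (hb : b ≤ n + 1)
    (hPa : IsWeaklyKept (G.LeftLabel n u) (G.RightLabel n u) a)
    (hPb : IsWeaklyKept (G.LeftLabel n u) (G.RightLabel n u) b)
    (hne : ¬ (G.LeftLabel n u a ↔ G.LeftLabel n u b)) : ¬ G.Adj (u a) (u b) := by
  intro hadj
  have h1 := h.not_left_right ha hab hb hadj
  have h2 := h.not_right_left ha hab hadj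
  rw [IsWeaklyKept] at hPa hPb
  tauto

lemma not_adj_of_isKept (h : G.IsCriticalPath n u)
    {a b : ℕ} (ha : 2 ≤ a) (hab : a < b) (hb : b ≤ n + 1)
    (hPa : IsKept (G.LeftLabel n u) (G.RightLabel n u) a)
    (hPb : IsKept (G.LeftLabel n u) (G.RightLabel n u) b)
    (hne : keptClass (G.LeftLabel n u) (G.RightLabel n u) n a ≠
      keptClass (G.LeftLabel n u) (G.RightLabel n u) n b) : ¬ G.Adj (u a) (u b) := by
  intro hadj
  have h1 := h.not_left_right ha hab hb hadj
  have h2 := h.not_right_left ha hab hadj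
  have h3 := h.not_right_left_outer hab hb hadj
  have h4 := h.isLabelling.not_and (a - 1)
  have h5 := h.isLabelling.not_and (b - 1)
  have h6 := h.isLabelling.not_and a
  have h7 := h.isLabelling.not_and b
  rw [keptClass, keptClass] at hne
  rw [IsKept] at hPa hPb
  rcases hPa with ⟨a1, a2⟩ | ⟨a1, a2, a3⟩ | ⟨a1, a2, a3⟩ <;>
    rcases hPb with ⟨b1, b2⟩ | ⟨b1, b2, b3⟩ | ⟨b1, b2, b3⟩ <;> grind

lemma isKept_two (h : G.IsCriticalPath n u) : IsKept (G.LeftLabel n u) (G.RightLabel n u) 2 :=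
  Or.inr (Or.inl ⟨Or.inl (by omega), Or.inl (by omega), h.leftLabel_two⟩)

lemma isKept_add_one (h : G.IsCriticalPath n u)
    : IsKept (G.LeftLabel n u) (G.RightLabel n u) (n + 1) :=
  Or.inr (Or.inr ⟨h.rightLabel_self, Or.inl (by omega), Or.inl (by omega)⟩)

variable [DecidablePred (G.LeftLabel n u)] [DecidablePred (G.RightLabel n u)]

lemma card_blanks_add (h : G.IsCriticalPath n u) [DecidableRel G.Adj] :
    (blanks n (G.LeftLabel n u) (G.RightLabel n u)).card + G.degree (u 2) +
      G.degree (u (n + 1)) + 1 = n := by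
  have h3 := h.three_le
  have hX : G.degree (u 2) = ((Finset.Icc 2 n).filter (G.LeftLabel n u)).card := by
    rw [← card_neighborFinset_eq_degree, neighborFinset_eq_filter, h.card_eq]
    symm
    refine Finset.card_bij (fun a _ => a + 1) ?_ (fun a _ b _ hab => by omega) ?_
    · intro a ha
      simp only [Finset.mem_filter, Finset.mem_Icc, LeftLabel] at ha ⊢
      obtain ⟨h1, h2 | h2⟩ := ha
      · omega
      · exact ⟨by omega, h2.2⟩
    · intro b hb
      simp only [Finset.mem_filter, Finset.mem_Icc] at hb
      have hb2 : b ≠ 2 := by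
        rintro rfl
        exact G.loopless.irrefl _ hb.2
      refine ⟨b - 1, ?_, by omega⟩
      simp only [Finset.mem_filter, Finset.mem_Icc, LeftLabel]
      exact ⟨by omega, Or.inr ⟨by omega, by rw [show b - 1 + 1 = b by omega]; exact hb.2⟩⟩
  have hY : G.degree (u (n + 1)) = ((Finset.Icc 2 n).filter (G.RightLabel n u)).card := by
    rw [← card_neighborFinset_eq_degree, neighborFinset_eq_filter, h.card_eq]
    congr 1
    ext a
    simp only [Finset.mem_filter, Finset.mem_Icc, RightLabel]
    constructor
    · rintro ⟨h1, h2⟩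
      have : a ≠ n + 1 := by
        rintro rfl
        exact G.loopless.irrefl _ h2
      exact ⟨by omega, Or.inr ⟨h1.1, h2⟩⟩
    · rintro ⟨h1, h2 | h2⟩
      · omega
      · exact ⟨by omega, h2.2⟩
  have hN : blanks n (G.LeftLabel n u) (G.RightLabel n u) =
      (Finset.Icc 2 n).filter fun a => ¬ G.LeftLabel n u a ∧ ¬ G.RightLabel n u a := by
    ext a
    rw [h.isLabelling.mem_blanks_iff, Finset.mem_filter, Finset.mem_Icc]
    exact ⟨fun h' => ⟨⟨h.isLabelling.two_le h'.1, h.isLabelling.le_of_not h'.2⟩, h'⟩,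
      fun h' => h'.2⟩
  have hYN : ((Finset.Icc 2 n).filter fun a => ¬ G.LeftLabel n u a) =
      (Finset.Icc 2 n).filter (G.RightLabel n u) ∪
      (Finset.Icc 2 n).filter fun a => ¬ G.LeftLabel n u a ∧ ¬ G.RightLabel n u a := by
    ext a
    have := h.isLabelling.not_and a
    simp only [Finset.mem_filter, Finset.mem_union]
    tauto
  have hdisj : Disjoint ((Finset.Icc 2 n).filter (G.RightLabel n u))
      ((Finset.Icc 2 n).filter fun a => ¬ G.LeftLabel n u a ∧ ¬ G.RightLabel n u a) := by
    rw [Finset.disjoint_left]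
    intro a ha hb
    exact (Finset.mem_filter.1 hb).2.2 (Finset.mem_filter.1 ha).2
  have h4 := Finset.card_filter_add_card_filter_not (s := Finset.Icc 2 n) (G.LeftLabel n u)
  rw [hYN, Finset.card_union_of_disjoint hdisj, Nat.card_Icc] at h4
  rw [hX, hY, hN]
  omega

lemma two_mul_le_of_descents_eq_empty (h : G.IsCriticalPath n u) (hG : SeparatorBound t G)
    (h0 : descents n (G.LeftLabel n u) (G.RightLabel n u) = ∅) :
    2 * t ≤ 4 * (blanks n (G.LeftLabel n u) (G.RightLabel n u)).card + 1 := by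
  classical
  have h3 := h.three_le
  have hX := h.leftLabel_two
  have hY : G.RightLabel n u (n + 1) := Or.inl le_rfl
  have hYX : ¬ G.LeftLabel n u (n + 1) := fun h' => h.isLabelling.not_and _ ⟨h', hY⟩
  refine le_trans ?_ (h.isLabelling.card_not_isWeaklyKept_le h0)
  have hcard : ({2, n + 1} : Finset ℕ).card = 2 := Finset.card_pair (by omega)
  have := h.toIsPathEnum.separatorBound hG
    (P := IsWeaklyKept (G.LeftLabel n u) (G.RightLabel n u))
    (c := fun a => if G.LeftLabel n u a then 2 else n + 1) (F := {2, n + 1}) ?_ hcard.ge ?_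
  · rw [hcard] at this
    linarith
  · intro r hr
    simp only [Finset.mem_insert, Finset.mem_singleton] at hr
    rcases hr with rfl | rfl
    · exact ⟨by omega, Or.inl hX, by simp [hX]⟩
    · exact ⟨by omega, Or.inr ⟨h.rightLabel_self, hY, Or.inl (by omega)⟩, by simp [hYX]⟩
  · intro a b ha hab hb hPa hPb hne
    refine h.not_adj_of_isWeaklyKept ha hab hb hPa hPb fun hiff => hne ?_
    simp only [hiff]

lemma card_insert_descents (h : G.IsCriticalPath n u) :
    (insert 2 (insert (n + 1) (descents n (G.LeftLabel n u) (G.RightLabel n u)))).card =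
      (descents n (G.LeftLabel n u) (G.RightLabel n u)).card + 2 := by
  have h3 := h.three_le
  rw [Finset.card_insert_of_notMem, Finset.card_insert_of_notMem]
  · intro h'
    exact h.isLabelling.not_and _ ⟨(h.isLabelling.mem_descents_iff.1 h').2, Or.inl le_rfl⟩
  · rw [Finset.mem_insert, not_or]
    refine ⟨by omega, fun h' => h.isLabelling.not_and 1
      ⟨Or.inl le_rfl, (h.isLabelling.mem_descents_iff.1 h').1⟩⟩

lemma mem_insert_descents (h : G.IsCriticalPath n u) {a : ℕ}
    (ha : a ∈ insert 2 (insert (n + 1) (descents n (G.LeftLabel n u) (G.RightLabel n u)))) :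
    (2 ≤ a ∧ a ≤ n + 1) ∧ IsKept (G.LeftLabel n u) (G.RightLabel n u) a ∧
      keptClass (G.LeftLabel n u) (G.RightLabel n u) n a = a := by
  have h3 := h.three_le
  rw [Finset.mem_insert, Finset.mem_insert, mem_descents] at ha
  rcases ha with rfl | rfl | ⟨hI, ha⟩
  · refine ⟨by omega, h.isKept_two, ?_⟩
    simp [keptClass, h.leftLabel_two]
  · refine ⟨by omega, h.isKept_add_one, ?_⟩
    have hYX : ¬ G.LeftLabel n u (n + 1) := fun h' =>
      h.isLabelling.not_and _ ⟨h', Or.inl le_rfl⟩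
    simp [keptClass, hYX]
  · refine ⟨hI, Or.inl ha, ?_⟩
    simp [keptClass, ha.1, ha.2]

lemma mul_card_descents_le (h : G.IsCriticalPath n u) (hG : SeparatorBound t G) :
    t * ((descents n (G.LeftLabel n u) (G.RightLabel n u)).card + 2) ≤
      3 * (descents n (G.LeftLabel n u) (G.RightLabel n u)).card +
      5 * (blanks n (G.LeftLabel n u) (G.RightLabel n u)).card + 1 := by
  classical
  rw [← h.card_insert_descents]
  refine le_trans (h.toIsPathEnum.separatorBound hG
    (P := IsKept (G.LeftLabel n u) (G.RightLabel n u))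
    (c := keptClass (G.LeftLabel n u) (G.RightLabel n u) n) ?_ ?_ ?_)
    h.isLabelling.card_not_isKept_le
  · exact fun r hr => h.mem_insert_descents hr
  · rw [h.card_insert_descents]
    omega
  · exact fun a b ha hab hb hPa hPb hne => h.not_adj_of_isKept ha hab hb hPa hPb hne

lemma succ_mul_card_descents_le (h : G.IsCriticalPath n u) (hG : SeparatorBound t G) :
    (t + 1) * ((descents n (G.LeftLabel n u) (G.RightLabel n u)).card + 2) ≤ n := by
  have hne : ∀ a b, a ∈ insert 2 (insert (n + 1)
      (descents n (G.LeftLabel n u) (G.RightLabel n u))) → b ∈ insert 2 (insert (n + 1)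
      (descents n (G.LeftLabel n u) (G.RightLabel n u))) → a < b → ¬ G.Adj (u a) (u b) := by
    intro a b ha hb hab
    obtain ⟨hIa, hPa, hca⟩ := h.mem_insert_descents ha
    obtain ⟨hIb, hPb, hcb⟩ := h.mem_insert_descents hb
    exact h.not_adj_of_isKept hIa.1 hab hIb.2 hPa hPb (by rw [hca, hcb]; exact hab.ne)
  have hcard : ((insert 2 (insert (n + 1)
      (descents n (G.LeftLabel n u) (G.RightLabel n u)))).image u).card =
      (descents n (G.LeftLabel n u) (G.RightLabel n u)).card + 2 := by
    rw [← h.card_insert_descents]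
    refine Finset.card_image_of_injOn fun a ha b hb hab => ?_
    have h1 := (h.mem_insert_descents ha).1
    have h2 := (h.mem_insert_descents hb).1
    exact h.injOn ⟨h1.1, Nat.lt_succ_of_le h1.2⟩ ⟨h2.1, Nat.lt_succ_of_le h2.2⟩ hab
  have := hG.le_card_of_isIndepSet (R := (insert 2 (insert (n + 1)
      (descents n (G.LeftLabel n u) (G.RightLabel n u)))).image u) ?_ (by omega)
  · rwa [hcard, h.card_eq_self] at this
  · intro v hv w hw hvw
    obtain ⟨a, ha, rfl⟩ := Finset.mem_image.1 hv
    obtain ⟨b, hb, rfl⟩ := Finset.mem_image.1 hw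
    rcases lt_trichotomy a b with hlt | rfl | hlt
    · exact hne a b ha hb hlt hvw
    · exact G.loopless.irrefl _ hvw
    · exact hne b a hb ha hlt hvw.symm

lemma card_le_card_ascents (h : G.IsCriticalPath n u)
    {U : Finset V} (hU : ∀ v ∈ U, ∀ w, w ≠ v → G.Adj v w) :
    U.card ≤ (ascents n (G.LeftLabel n u) (G.RightLabel n u)).card := by
  have h3 := h.three_le
  have hne : u 2 ≠ u (n + 1) := h.toIsPathEnum.ne le_rfl (by omega) le_rfl
  have hsub : U ⊆ (ascents n (G.LeftLabel n u) (G.RightLabel n u)).image u := by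
    intro v hv
    obtain ⟨a, h1, h2, rfl⟩ := h.surj v
    have ha2 : u 2 ≠ u a := fun he => h.not_adj (by rw [he]; exact hU _ hv _ (he ▸ hne.symm))
    have hab : u (n + 1) ≠ u a := fun he =>
      h.not_adj (by rw [he]; exact (hU _ hv _ (he ▸ hne)).symm)
    have ha2' : a ≠ 2 := fun he => ha2 (by rw [he])
    refine Finset.mem_image_of_mem _ (mem_ascents.2 ⟨by omega, Or.inr ⟨by omega, ?_⟩,
      Or.inr ⟨by omega, (hU _ hv _ hab).symm⟩⟩)
    rw [show a - 1 + 1 = a by omega]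
    exact (hU _ hv _ ha2).symm
  exact (Finset.card_le_card hsub).trans Finset.card_image_le

end IsCriticalPath

end PathLabels

section Closure

variable {V : Type*} [Fintype V] [DecidableEq V] {G : SimpleGraph V} {n t : ℕ} {u : ℕ → V}

lemma IsCriticalPath.degree_add_degree_lt (h : G.IsCriticalPath n u) (hG : SeparatorBound t G)
    (ht : 4 ≤ t) [DecidableRel G.Adj] : G.degree (u 2) + G.degree (u (n + 1)) + t / 2 < n := by
  classical
  have hs := h.card_blanks_add
  by_contra! hlt
  rcases Finset.eq_empty_or_nonempty (descents n (G.LeftLabel n u) (G.RightLabel n u)) with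
    h0 | h0
  · have := h.two_mul_le_of_descents_eq_empty hG h0
    omega
  · have h1 := h.mul_card_descents_le hG
    have h2 := h0.card_pos
    set k := (descents n (G.LeftLabel n u) (G.RightLabel n u)).card
    set s := (blanks n (G.LeftLabel n u) (G.RightLabel n u)).card
    have h3 : 2 * s + 2 ≤ t := by omega
    obtain ⟨k, hk⟩ : ∃ k', k = k' + 1 := ⟨k - 1, by omega⟩
    rw [hk] at h1
    nlinarith [Nat.mul_le_mul_right k ht]

lemma Walk.IsHamiltonian.exists_isCriticalPath {x y : V} {q : G.Walk x y} (hq : q.IsHamiltonian)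
    (h3 : 3 ≤ Fintype.card V) (hG : ¬ G.IsHamiltonian) (hxy : ¬ G.Adj x y) :
    ∃ u, G.IsCriticalPath (Fintype.card V) u ∧ u 2 = x ∧ u (Fintype.card V + 1) = y := by
  obtain ⟨u, hu, rfl, rfl⟩ := hq.exists_isPathEnum 2
  rw [add_comm] at hu
  rw [show 2 + Fintype.card V - 1 = Fintype.card V + 1 by omega] at hxy ⊢
  exact ⟨u, ⟨hu, rfl, h3, hG, hxy⟩, rfl, rfl⟩

lemma isHamiltonian_of_forall_adj (h3 : 3 ≤ Fintype.card V) (h : ∀ x y, x ≠ y → G.Adj x y) :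
    G.IsHamiltonian := by
  have hnd := (Finset.univ : Finset V).nodup_toList
  have hlen : (Finset.univ : Finset V).toList.length = Fintype.card V := by simp
  refine isHamiltonian_of_list h3 Finset.univ.toList ?_ hnd (by simp) ?_
  · exact List.Pairwise.isChain (List.Pairwise.imp (fun hab => h _ _ hab) hnd)
  · generalize (Finset.univ : Finset V).toList = l at hnd hlen
    match l with
    | [] => simp
    | [a] => simp at hlen; omega
    | a :: b :: l =>
      intro c hc d hd
      rw [List.head?_cons, Option.mem_some_iff] at hd
      subst hd
      rw [List.getLast?_cons_cons] at hc
      refine h _ _ ?_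
      rintro rfl
      exact (List.nodup_cons.1 hnd).1 (List.mem_of_getLast? hc)

/-- Universal vertices force descents, whose positions yield an independent set; its size is
bounded by toughness. -/
lemma IsCriticalPath.exists_card_le (h : G.IsCriticalPath n u) (hG : SeparatorBound t G)
    [DecidableRel G.Adj] {U : Finset V} (hU : ∀ v ∈ U, ∀ w, w ≠ v → G.Adj v w) :
    ∃ k s, s + G.degree (u 2) + G.degree (u (n + 1)) + 1 = n ∧ U.card ≤ k + s + 1 ∧
      (t + 1) * (k + 2) ≤ n := by
  classical
  exact ⟨_, _, h.card_blanks_add, (h.card_le_card_ascents hU).trans h.isLabelling.card_ascents_le,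
    h.succ_mul_card_descents_le hG⟩

end Closure

lemma card_bound_contradiction {n t i j D μ a k s : ℕ} (ht : 4 ≤ t) (hi : i = μ + D)
    (hi2 : 2 * t ≤ i) (hin : 2 * i + t / 2 < n) (hj : j = min (i + t / 2) ((n - 1) / 2))
    (hμ : j + 1 ≤ μ + t) (ha1 : i + t / 2 ≤ a * (D + 1)) (ha2 : t * (a + 1) ≤ μ + a * D)
    (hs : s + 2 * i + 1 ≤ n) (hk1 : μ ≤ k + s + 1) (hk2 : (t + 1) * (k + 2) ≤ n) : False := by
  rcases le_or_gt (i + t / 2) ((n - 1) / 2) with hm | hm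
  · have h2D : 2 * D + 1 ≤ t := by omega
    have ha3 : i ≤ a * (D + 1) := by omega
    linarith [Nat.mul_le_mul_left a h2D]
  · have hDt : D + 2 ≤ t := by omega
    have ha : 2 ≤ a := by
      by_contra hlt
      have : a * (D + 1) ≤ 1 * (D + 1) := Nat.mul_le_mul_right _ (by omega)
      omega
    have hi3 : 2 * t + 2 ≤ i := by
      obtain ⟨e, rfl⟩ := Nat.exists_eq_add_of_le hDt
      obtain ⟨b, rfl⟩ := Nat.exists_eq_add_of_le ha
      linarith [Nat.zero_le (e * b)]
    have hn1 : 4 * t + 5 ≤ n := by omega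
    have hk3 : n + 4 ≤ 2 * (k + 2) + 4 * t := by omega
    obtain ⟨m, rfl⟩ := Nat.exists_eq_add_of_le hn1
    have hk4 : m + 9 ≤ 2 * (k + 2) := by omega
    linarith [Nat.mul_le_mul_left (t + 1) hk4, Nat.mul_le_mul_right m ht]

section DegreePart

variable {V : Type*} [Fintype V] [DecidableEq V] {G : SimpleGraph V} [DecidableRel G.Adj] {t : ℕ}

/-- `x` and `y` are nonadjacent, and `x` has the largest degree among the vertices not adjacent
to `y`, but not more than `y`. -/
structure IsDominatingPair (G : SimpleGraph V) [DecidableRel G.Adj] (x y : V) : Prop where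
  ne : x ≠ y
  not_adj : ¬ G.Adj x y
  degree_le : G.degree x ≤ G.degree y
  degree_le_of_not_adj : ∀ w, w ≠ y → ¬ G.Adj w y → G.degree w ≤ G.degree x

lemma exists_max_degree_not_adj {v y : V} (hne : v ≠ y) (hadj : ¬ G.Adj v y) :
    ∃ x, x ≠ y ∧ ¬ G.Adj x y ∧ ∀ w, w ≠ y → ¬ G.Adj w y → G.degree w ≤ G.degree x := by
  obtain ⟨x, hx, hmax⟩ := Finset.exists_max_image
    (Finset.univ.filter fun w => w ≠ y ∧ ¬ G.Adj w y) (fun w => G.degree w)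
    ⟨v, by simp [hne, hadj]⟩
  simp only [Finset.mem_filter, Finset.mem_univ, true_and] at hx hmax
  exact ⟨x, hx.1, hx.2, fun w h1 h2 => hmax w ⟨h1, h2⟩⟩

lemma exists_isDominatingPair {v w : V} (hne : v ≠ w) (hadj : ¬ G.Adj v w) :
    ∃ x y, G.IsDominatingPair x y := by
  obtain ⟨y, hy, hmax⟩ := Finset.exists_max_image
    (Finset.univ.filter fun y => ∃ w, w ≠ y ∧ ¬ G.Adj w y) (fun w => G.degree w)
    ⟨w, by simpa using ⟨v, hne, hadj⟩⟩
  simp only [Finset.mem_filter, Finset.mem_univ, true_and] at hy hmax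
  obtain ⟨w, h1, h2⟩ := hy
  obtain ⟨x, hx, hxy, hx'⟩ := exists_max_degree_not_adj h1 h2
  exact ⟨x, y, hx, hxy, hmax x ⟨y, hx.symm, fun h => hxy h.symm⟩, hx'⟩

lemma exists_maximal_indep_subset (G : SimpleGraph V) (W : Finset V) :
    ∃ I ⊆ W, (∀ a ∈ I, ∀ b ∈ I, ¬ G.Adj a b) ∧ ∀ w ∈ W, w ∈ I ∨ ∃ a ∈ I, G.Adj a w := by
  classical
  obtain ⟨I, hI, hmax⟩ := Finset.exists_max_image
    (W.powerset.filter fun I => ∀ a ∈ I, ∀ b ∈ I, ¬ G.Adj a b) Finset.card ⟨∅, by simp⟩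
  simp only [Finset.mem_filter, Finset.mem_powerset] at hI hmax
  refine ⟨I, hI.1, hI.2, fun w hw => ?_⟩
  by_contra! hcon
  have := hmax (insert w I) ⟨Finset.insert_subset hw hI.1, ?_⟩
  · rw [Finset.card_insert_of_notMem hcon.1] at this
    omega
  · intro a ha b hb hab
    rw [Finset.mem_insert] at ha hb
    rcases ha with rfl | ha <;> rcases hb with rfl | hb
    · exact G.loopless.irrefl _ hab
    · exact hcon.2 b hb hab.symm
    · exact hcon.2 a ha hab
    · exact hI.2 a ha b hb hab

lemma card_not_adj_add_degree (y : V) :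
    (Finset.univ.filter fun w => w ≠ y ∧ ¬ G.Adj w y).card + G.degree y + 1 = Fintype.card V := by
  have h1 : (Finset.univ.filter fun w => w ≠ y ∧ ¬ G.Adj w y) =
      (insert y (G.neighborFinset y))ᶜ := by
    ext w
    simp [G.adj_comm]
  have h2 := Finset.card_add_card_compl (insert y (G.neighborFinset y))
  rw [Finset.card_insert_of_notMem (by simp), card_neighborFinset_eq_degree] at h2
  rw [h1]
  omega

/-- In a vertex set `W` of vertices of degree at most `μ + D`, all adjacent to a set `U` of size
`μ` disjoint from `W`, a maximal independent subset is large. -/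
lemma SeparatorBound.exists_card_indep (hG : SeparatorBound t G) {W U : Finset V} {y : V} {D : ℕ}
    (hne : W.Nonempty) (hy : y ∉ W) (hWy : ∀ w ∈ W, ¬ G.Adj w y) (hU : ∀ w ∈ W, w ∉ U)
    (hWU : ∀ w ∈ W, ∀ v ∈ U, G.Adj w v) (hdeg : ∀ w ∈ W, G.degree w ≤ U.card + D) :
    ∃ a, W.card ≤ a * (D + 1) ∧ t * (a + 1) ≤ U.card + a * D := by
  obtain ⟨I, hIW, hind, hmax⟩ := exists_maximal_indep_subset G W
  have hcard : ∀ a ∈ I, (G.neighborFinset a \ U).card ≤ D := by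
    intro a ha
    have hsub : U ⊆ G.neighborFinset a := fun v hv => by
      simpa using hWU a (hIW ha) v hv
    have := hdeg a (hIW ha)
    rw [Finset.card_sdiff_of_subset hsub, card_neighborFinset_eq_degree]
    omega
  have hIne : I.Nonempty := by
    obtain ⟨w, hw⟩ := hne
    rcases hmax w hw with h | ⟨a, ha, -⟩
    exacts [⟨w, h⟩, ⟨a, ha⟩]
  refine ⟨I.card, ?_, ?_⟩
  · have hsub : W ⊆ I.biUnion fun a => insert a (G.neighborFinset a \ U) := by
      intro w hw
      rw [Finset.mem_biUnion]
      rcases hmax w hw with h | ⟨a, ha, haw⟩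
      · exact ⟨w, h, Finset.mem_insert_self _ _⟩
      · exact ⟨a, ha, Finset.mem_insert_of_mem (by simpa using ⟨haw, hU w hw⟩)⟩
    refine (Finset.card_le_card hsub).trans (Finset.card_biUnion_le_card_mul _ _ _ fun a ha => ?_)
    exact (Finset.card_insert_le _ _).trans (Nat.succ_le_succ (hcard a ha))
  · refine (hG.le_card_neighbors hind hIne (fun h => hy (hIW h))
      fun a ha => hWy a (hIW ha)).trans ?_
    have hsub : (Finset.univ.filter fun v => ∃ a ∈ I, G.Adj a v) ⊆
        U ∪ I.biUnion fun a => G.neighborFinset a \ U := by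
      intro v hv
      simp only [Finset.mem_filter, Finset.mem_univ, true_and] at hv
      obtain ⟨a, ha, hav⟩ := hv
      rw [Finset.mem_union, Finset.mem_biUnion]
      by_cases hvU : v ∈ U
      · exact Or.inl hvU
      · exact Or.inr ⟨a, ha, by simpa using ⟨hav, hvU⟩⟩
    refine (Finset.card_le_card hsub).trans ((Finset.card_union_le _ _).trans ?_)
    exact Nat.add_le_add_left (Finset.card_biUnion_le_card_mul _ _ _ hcard) _

lemma not_isDominatingPair (ht : 4 ≤ t) (hG : SeparatorBound t G)
    (hsum : ∀ x y, x ≠ y → ¬ G.Adj x y → G.degree x + G.degree y + t / 2 < Fintype.card V)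
    (huniv : ∀ x y, x ≠ y → ¬ G.Adj x y → ∀ U : Finset V, (∀ v ∈ U, ∀ w, w ≠ v → G.Adj v w) →
      ∃ k s, s + G.degree x + G.degree y + 1 = Fintype.card V ∧ U.card ≤ k + s + 1 ∧
        (t + 1) * (k + 2) ≤ Fintype.card V)
    (hcond : ∀ j, 1 ≤ j → 2 * j < Fintype.card V →
      j ≤ (Finset.univ.filter fun v => G.degree v ≤ j).card →
      j + 1 ≤ (Finset.univ.filter fun v => Fintype.card V - j ≤ G.degree v).card + t)
    (x y : V) : ¬ G.IsDominatingPair x y := by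
  intro h
  induction hi : G.degree x using Nat.strong_induction_on generalizing x y with
  | _ i ih =>
  set n := Fintype.card V with hn
  have hxy := hsum x y h.ne h.not_adj
  have hi2 := hG.two_mul_le_degree h.ne h.not_adj
  have hle := h.degree_le
  have hcardW := card_not_adj_add_degree (G := G) y
  set W := Finset.univ.filter fun w => w ≠ y ∧ ¬ G.Adj w y with hW
  have hmemW : ∀ w, w ∈ W ↔ w ≠ y ∧ ¬ G.Adj w y := fun w => by simp [hW]
  have hWdeg : ∀ w ∈ W, G.degree w ≤ i := fun w hw =>
    hi ▸ h.degree_le_of_not_adj w ((hmemW w).1 hw).1 ((hmemW w).1 hw).2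
  obtain ⟨j, hj⟩ : ∃ j, j = min (i + t / 2) ((n - 1) / 2) := ⟨_, rfl⟩
  have hij : i ≤ j := by omega
  have hjn : 2 * j < n := by omega
  have hUcard := hcond j (by omega) hjn (by
    have : W ⊆ Finset.univ.filter fun v => G.degree v ≤ j := fun w hw => by
      simpa using (hWdeg w hw).trans hij
    have := Finset.card_le_card this
    omega)
  set U := Finset.univ.filter fun v => n - j ≤ G.degree v with hU
  have hmemU : ∀ w, w ∈ U ↔ n - j ≤ G.degree w := fun w => by simp [hU]
  have hUniv : ∀ v ∈ U, ∀ w, w ≠ v → G.Adj v w := by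
    intro v hv w hw
    by_contra hadj
    obtain ⟨z, hz, hzv, hmax⟩ := exists_max_degree_not_adj hw (fun h' => hadj h'.symm)
    have h1 := hsum z v hz hzv
    have h2 := (hmemU v).1 hv
    exact ih (G.degree z) (by omega) z v ⟨hz, hzv, by omega, hmax⟩ rfl
  have hWU : ∀ w ∈ W, w ∉ U := fun w hw hw' => by
    have h1 := hWdeg w hw
    have h2 := (hmemU w).1 hw'
    omega
  have hWUadj : ∀ w ∈ W, ∀ v ∈ U, G.Adj w v := fun w hw v hv =>
    (hUniv v hv w fun he => hWU w hw (he ▸ hv)).symm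
  have hxW : x ∈ W := (hmemW x).2 ⟨h.ne, h.not_adj⟩
  have hUi : U.card ≤ i := by
    rw [← hi, ← card_neighborFinset_eq_degree]
    exact Finset.card_le_card fun v hv => by simpa using hWUadj x hxW v hv
  obtain ⟨D, hD⟩ := Nat.exists_eq_add_of_le hUi
  obtain ⟨a, ha1, ha2⟩ := hG.exists_card_indep (D := D) ⟨x, hxW⟩ (fun h' => ((hmemW y).1 h').1 rfl)
    (fun w hw => ((hmemW w).1 hw).2) hWU hWUadj (fun w hw => hD ▸ hWdeg w hw)
  obtain ⟨k, s, hs, hk1, hk2⟩ := huniv x y h.ne h.not_adj U hUniv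
  exact card_bound_contradiction ht hD (hi ▸ hi2) (by omega) hj hUcard (by omega) ha2 (by omega)
    hk1 hk2

end DegreePart

section DegreeSequence

variable {V : Type*} [Fintype V] [DecidableEq V] {G : SimpleGraph V} [DecidableRel G.Adj]
  {n t : ℕ} {v : ℕ → V}

/-- The condition on a degree sequence, in terms of the numbers of vertices of small and of
large degree. -/
lemma card_large_degree_of_degree_sequence (hbij : Set.BijOn v (Set.Icc 1 n) Set.univ)
    (hmono : ∀ i j, 1 ≤ i → i ≤ j → j ≤ n → G.degree (v i) ≤ G.degree (v j))
    (hcond : ∀ i, 1 ≤ i → 2 * i < n →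
      G.degree (v i) ≤ i → n - i ≤ G.degree (v (n - i + t)))
    {j : ℕ} (hj : 1 ≤ j) (hjn : 2 * j < n)
    (hsmall : j ≤ (Finset.univ.filter fun w => G.degree w ≤ j).card) :
    j + 1 ≤ (Finset.univ.filter fun w => n - j ≤ G.degree w).card + t := by
  have hdeg : G.degree (v j) ≤ j := by
    by_contra! hlt
    have hsub : (Finset.univ.filter fun w => G.degree w ≤ j) ⊆
        (Finset.Icc 1 (j - 1)).image v := by
      intro w hw
      obtain ⟨i, hi, rfl⟩ := hbij.surjOn (Set.mem_univ w)
      rw [Set.mem_Icc] at hi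
      refine Finset.mem_image_of_mem v (Finset.mem_Icc.2 ⟨hi.1, ?_⟩)
      by_contra! hij
      have := hmono j i hj (by omega) hi.2
      have := (Finset.mem_filter.1 hw).2
      omega
    have := (Finset.card_le_card hsub).trans Finset.card_image_le
    rw [Nat.card_Icc] at this
    omega
  have hlarge := hcond j hj hjn hdeg
  rcases lt_or_ge j t with hjt | hjt
  · omega
  have hsub : (Finset.Icc (n - j + t) n).image v ⊆
      Finset.univ.filter fun w => n - j ≤ G.degree w := by
    intro w hw
    obtain ⟨i, hi, rfl⟩ := Finset.mem_image.1 hw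
    rw [Finset.mem_Icc] at hi
    have := hmono (n - j + t) i (by omega) hi.1 hi.2
    simpa using hlarge.trans this
  have hcard := Finset.card_le_card hsub
  rw [Finset.card_image_of_injOn, Nat.card_Icc] at hcard
  · omega
  · refine hbij.injOn.mono fun i hi => ?_
    rw [Finset.coe_Icc, Set.mem_Icc] at hi
    exact ⟨by omega, hi.2⟩

end DegreeSequence

section MaximalNonHamiltonian

variable {V : Type*} [Fintype V] [DecidableEq V] {G : SimpleGraph V} {t : ℕ}

lemma exists_isCriticalPath_of_maximal
    (hmax : Maximal (fun H : SimpleGraph V => ¬ H.IsHamiltonian) G) (h3 : 3 ≤ Fintype.card V)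
    {x y : V} (hne : x ≠ y) (hxy : ¬ G.Adj x y) :
    ∃ u, G.IsCriticalPath (Fintype.card V) u ∧ u 2 = x ∧ u (Fintype.card V + 1) = y := by
  have hlt : G < G ⊔ edge x y := by
    refine lt_of_le_of_ne le_sup_left fun he => hxy ?_
    rw [he]
    exact Or.inr ((edge_adj ..).2 ⟨Or.inl ⟨rfl, rfl⟩, hne⟩)
  obtain ⟨q, hq⟩ := exists_isHamiltonian_path_of_sup_edge h3 hmax.prop
    (not_not.1 (hmax.not_prop_of_gt hlt))
  exact hq.exists_isCriticalPath h3 hmax.prop hxy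

lemma isHamiltonian_of_separatorBound [DecidableRel G.Adj] (h3 : 3 ≤ Fintype.card V) (ht : 4 ≤ t)
    (hG : SeparatorBound t G)
    (hcond : ∀ j, 1 ≤ j → 2 * j < Fintype.card V →
      j ≤ (Finset.univ.filter fun v => G.degree v ≤ j).card →
      j + 1 ≤ (Finset.univ.filter fun v => Fintype.card V - j ≤ G.degree v).card + t) :
    G.IsHamiltonian := by
  classical
  by_contra hnot
  obtain ⟨H, hGH, hmax⟩ := Finite.exists_le_maximal
    (p := fun H : SimpleGraph V => ¬ H.IsHamiltonian) hnot
  have hH := hG.mono hGH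
  obtain ⟨x, y, hne, hxy⟩ : ∃ x y, x ≠ y ∧ ¬ H.Adj x y := by
    by_contra! hcomplete
    exact hmax.prop (isHamiltonian_of_forall_adj h3 hcomplete)
  obtain ⟨x, y, hdom⟩ := exists_isDominatingPair hne hxy
  have hdeg : ∀ v, G.degree v ≤ H.degree v := fun v => degree_le_of_le hGH
  refine not_isDominatingPair ht hH ?_ ?_ ?_ x y hdom
  · intro x y hne hxy
    obtain ⟨u, hu, rfl, rfl⟩ := exists_isCriticalPath_of_maximal hmax h3 hne hxy
    exact hu.degree_add_degree_lt hH ht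
  · intro x y hne hxy U hU
    obtain ⟨u, hu, rfl, rfl⟩ := exists_isCriticalPath_of_maximal hmax h3 hne hxy
    exact hu.exists_card_le hH hU
  · intro j hj hjn hsmall
    refine (hcond j hj hjn (hsmall.trans (Finset.card_le_card fun v hv => ?_))).trans
      (Nat.add_le_add_right (Finset.card_le_card fun v hv => ?_) t)
    · rw [Finset.mem_filter] at hv ⊢
      exact ⟨hv.1, (hdeg v).trans hv.2⟩
    · rw [Finset.mem_filter] at hv ⊢
      exact ⟨hv.1, hv.2.trans (hdeg v)⟩

end MaximalNonHamiltonian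

end SimpleGraph

/-- Theorem (main): a `t`-tough graph (`t ≥ 4` an integer) on `n ≥ 3` vertices whose
degree sequence `d_1 ≤ ⋯ ≤ d_n` satisfies: for all `1 ≤ i < n/2`, `d_i ≤ i` implies
`d_{n-i+t} ≥ n - i`, is Hamiltonian. -/
theorem degree_sequence_tough_hamiltonian
    {V : Type*} [Fintype V] [DecidableEq V] (G : SimpleGraph V) [DecidableRel G.Adj]
    (n t : ℕ) (ht : 4 ≤ t) (hn : Fintype.card V = n) (hn3 : 3 ≤ n)
    (htough : SimpleGraph.Tough (t : ℚ) G)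
    (v : ℕ → V) (hbij : Set.BijOn v (Set.Icc 1 n) Set.univ)
    (hmono : ∀ i j, 1 ≤ i → i ≤ j → j ≤ n → G.degree (v i) ≤ G.degree (v j))
    (hcond : ∀ i, 1 ≤ i → 2 * i < n →
      G.degree (v i) ≤ i → n - i ≤ G.degree (v (n - i + t))) :
    G.IsHamiltonian := by
  subst hn
  exact SimpleGraph.isHamiltonian_of_separatorBound hn3 ht htough.separatorBound
    fun _ hj hjn => SimpleGraph.card_large_degree_of_degree_sequence hbij hmono hcond hj hjn
end

section
/- Let t ≥ 4 be an integer and let G be a t-tough graph on n ≥ 3 vertices with degree sequence d_1 ≤ d_2 ≤ ⋯ ≤ d_n. If for every integer i with 1 ≤ i < n/2, d_i ≤ i implies d_{n−i+t} ≥ n−i, then G is pancyclic, i.e., G contains a cycle of every length ℓ with 3 ≤ ℓ ≤ n. -/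
/-- A cyclic ordering of all vertices in which consecutive vertices are adjacent. -/
def SimpleGraph.HasSpanningCycle {α : Type*} (H : SimpleGraph α) : Prop :=
  ∃ L : List α, L.Nodup ∧ (∀ x, x ∈ L) ∧ L.IsChain H.Adj ∧
    ∃ a b, L.head? = some a ∧ L.getLast? = some b ∧ H.Adj b a

/-- `L` is a chain for `R` that leads from `a` to `b`. -/
def IsChainBetween {β : Type*} (R : β → β → Prop) (a b : β) (L : List β) : Prop :=
  L.IsChain R ∧ L.head? = some a ∧ L.getLast? = some b

namespace IsChainBetween

variable {β : Type*} {R : β → β → Prop} {a b c d : β} {L L' : List β}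

lemma append (h : IsChainBetween R a b L) (hbc : R b c) (h' : IsChainBetween R c d L') :
    IsChainBetween R a d (L ++ L') := by
  obtain ⟨h1, h2, h3⟩ := h
  obtain ⟨h1', h2', h3'⟩ := h'
  refine ⟨List.isChain_append.2 ⟨h1, h1', ?_⟩, ?_, ?_⟩
  · intro x hx y hy
    simp_all
  · simp [List.head?_append, h2]
  · simp [List.getLast?_append, h3']

lemma reverse (hR : ∀ x y, R x y → R y x) (h : IsChainBetween R a b L) :
    IsChainBetween R b a L.reverse := by
  obtain ⟨h1, h2, h3⟩ := h
  refine ⟨?_, by simpa using h3, by simpa using h2⟩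
  rw [List.isChain_reverse]
  exact h1.imp hR

end IsChainBetween

/-- The vertices `v 0, …, v (N - 1)` form a spanning path of `H`. -/
structure SimpleGraph.IsSpanningPath {α : Type*} (H : SimpleGraph α) (N : ℕ) (v : ℕ → α) :
    Prop where
  inj : ∀ i j, i < N → j < N → v i = v j → i = j
  surj : ∀ x, ∃ i < N, v i = x
  adj : ∀ i, i + 1 < N → H.Adj (v i) (v (i + 1))

/-- The list `p, p + 1, …, q`. -/
def segUp (p q : ℕ) : List ℕ := List.range' p (q + 1 - p)

/-- The list `q, q - 1, …, p`. -/
def segDown (p q : ℕ) : List ℕ := (segUp p q).reverse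

@[simp] lemma mem_segUp {p q i : ℕ} : i ∈ segUp p q ↔ p ≤ i ∧ i ≤ q := by
  simp [segUp]; omega

@[simp] lemma mem_segDown {p q i : ℕ} : i ∈ segDown p q ↔ p ≤ i ∧ i ≤ q := by
  simp [segDown]

@[simp] lemma length_segUp {p q : ℕ} : (segUp p q).length = q + 1 - p := by
  simp [segUp]

@[simp] lemma length_segDown {p q : ℕ} : (segDown p q).length = q + 1 - p := by
  simp [segDown]

namespace SimpleGraph.IsSpanningPath

variable {α : Type*} {H : SimpleGraph α} {N : ℕ} {v : ℕ → α}

lemma up (hv : H.IsSpanningPath N v) {p q : ℕ} (hpq : p ≤ q) (hq : q < N) :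
    IsChainBetween (fun i j => H.Adj (v i) (v j)) p q (segUp p q) := by
  refine ⟨?_, ?_, ?_⟩
  · rw [List.isChain_iff_getElem]
    intro i hi
    simp only [length_segUp] at hi
    simp only [segUp, List.getElem_range', one_mul]
    rw [← add_assoc]
    exact hv.adj _ (by omega)
  · unfold segUp
    rw [List.head?_range', if_neg (by omega)]
  · unfold segUp
    rw [List.getLast?_range', if_neg (by omega)]
    congr 1; omega

lemma down (hv : H.IsSpanningPath N v) {p q : ℕ} (hpq : p ≤ q) (hq : q < N) :
    IsChainBetween (fun i j => H.Adj (v i) (v j)) q p (segDown p q) :=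
  (hv.up hpq hq).reverse fun _ _ h => h.symm

lemma hasSpanningCycle (hv : H.IsSpanningPath N v) {a b : ℕ} {L : List ℕ}
    (hL : IsChainBetween (fun i j => H.Adj (v i) (v j)) a b L) (hba : H.Adj (v b) (v a))
    (hlen : L.length = N) (hmem : ∀ i < N, i ∈ L) : H.HasSpanningCycle := by
  have hperm : (List.range N).Perm L := by
    refine List.Subperm.perm_of_length_le (List.nodup_range.subperm ?_) (by simp [hlen])
    intro i hi
    exact hmem i (by simpa using hi)
  obtain ⟨h1, h2, h3⟩ := hL
  refine ⟨L.map v, ?_, ?_, ?_, v a, v b, by simp [h2], by simp [h3], hba⟩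
  · refine (hperm.nodup_iff.1 List.nodup_range).map_on ?_
    intro x hx y hy hxy
    rw [← hperm.mem_iff, List.mem_range] at hx hy
    exact hv.inj x y hx hy hxy
  · intro x
    obtain ⟨i, hi, rfl⟩ := hv.surj x
    exact List.mem_map_of_mem (hmem i hi)
  · rw [List.isChain_map]
    exact h1

/-- Reversal of a spanning path. -/
lemma reverse (hv : H.IsSpanningPath N v) : H.IsSpanningPath N (fun i => v (N - 1 - i)) where
  inj i j hi hj h := by
    have := hv.inj _ _ (by omega) (by omega) h
    omega
  surj x := by
    obtain ⟨i, hi, rfl⟩ := hv.surj x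
    exact ⟨N - 1 - i, by omega, by congr 1; omega⟩
  adj i hi := by
    have := hv.adj (N - 1 - (i + 1)) (by omega)
    rw [show N - 1 - (i + 1) + 1 = N - 1 - i by omega] at this
    exact this.symm

lemma no_crossing (hv : H.IsSpanningPath N v) (hH : ¬ H.HasSpanningCycle) {m : ℕ}
    (hm : m + 1 < N) (ha : H.Adj (v 0) (v (m + 1))) (hb : H.Adj (v (N - 1)) (v m)) : False :=
  hH <| hv.hasSpanningCycle
    ((hv.up (Nat.zero_le m) (by omega)).append hb.symm
      (hv.down (p := m + 1) (q := N - 1) (by omega) (by omega)))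
    ha.symm (by simp; omega) (by intro i hi; simp; omega)

lemma no_chord_of_left_right (hv : H.IsSpanningPath N v) (hH : ¬ H.HasSpanningCycle) {i j : ℕ}
    (hij : i + 2 ≤ j) (hj : j < N) (h : H.Adj (v i) (v j)) (ha : H.Adj (v 0) (v (i + 1)))
    (hb : H.Adj (v (N - 1)) (v (j - 1))) : False :=
  hH <| hv.hasSpanningCycle
    (((hv.up (Nat.zero_le i) (by omega)).append h
      (hv.up (p := j) (q := N - 1) (by omega) (by omega))).append hb
      (hv.down (p := i + 1) (q := j - 1) (by omega) (by omega)))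
    ha.symm (by simp; omega) (by intro i hi; simp; omega)

lemma no_chord_of_right_left (hv : H.IsSpanningPath N v) (hH : ¬ H.HasSpanningCycle) {i j : ℕ}
    (hij : i < j) (hj : j + 1 < N) (h : H.Adj (v i) (v j)) (ha : H.Adj (v 0) (v (j + 1)))
    (hb : H.Adj (v (N - 1)) (v (i + 1))) : False :=
  hH <| hv.hasSpanningCycle
    (((hv.up (Nat.zero_le i) (by omega)).append h
      (hv.down (p := i + 1) (q := j) (by omega) (by omega))).append hb.symm
      (hv.down (p := j + 1) (q := N - 1) (by omega) (by omega)))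
    ha.symm (by simp; omega) (by intro i hi; simp; omega)

lemma no_left_neighbor (hv : H.IsSpanningPath N v) (hH : ¬ H.HasSpanningCycle) {m s z : ℕ}
    (hm : 1 ≤ m) (hms : m < s) (hs : s + 1 < N) (h : H.Adj (v m) (v (s + 1)))
    (hb : H.Adj (v (N - 1)) (v (m - 1))) (hz : z < s) (hsz : H.Adj (v s) (v z))
    (ha : H.Adj (v 0) (v (z + 1))) : False := by
  rcases lt_trichotomy z m with hzm | rfl | hzm
  · rcases Nat.lt_or_ge (z + 1) m with hzm | hzm'
    · exact hH <| hv.hasSpanningCycle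
        ((((hv.down (Nat.zero_le z) (by omega)).append ha
          (hv.up (p := z + 1) (q := m - 1) (by omega) (by omega))).append hb.symm
          (hv.down (p := s + 1) (q := N - 1) (by omega) (by omega))).append h.symm
          (hv.up (p := m) (q := s) (by omega) (by omega)))
        hsz (by simp; omega) (by intro i hi; simp; omega)
    · obtain rfl : m = z + 1 := by omega
      exact hv.no_crossing hH (by omega) ha hb
  · exact hH <| hv.hasSpanningCycle
      ((((hv.up (Nat.zero_le (z - 1)) (by omega)).append hb.symm
        (hv.down (p := s + 1) (q := N - 1) (by omega) (by omega))).append h.symm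
        (hv.up (p := z) (q := z) (by omega) (by omega))).append hsz.symm
        (hv.down (p := z + 1) (q := s) (by omega) (by omega)))
      ha.symm (by simp; omega) (by intro i hi; simp; omega)
  · exact hH <| hv.hasSpanningCycle
      ((((hv.up (p := z + 1) (q := s) (by omega) (by omega)).append hsz
        (hv.down (p := m) (q := z) (by omega) (by omega))).append h
        (hv.up (p := s + 1) (q := N - 1) (by omega) (by omega))).append hb
        (hv.down (Nat.zero_le (m - 1)) (by omega)))
      ha (by simp; omega) (by intro i hi; simp; omega)

lemma no_right_neighbor (hv : H.IsSpanningPath N v) (hH : ¬ H.HasSpanningCycle) {m s z : ℕ}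
    (hm : 1 ≤ m) (hms : m < s) (h : H.Adj (v m) (v (s + 1)))
    (hb : H.Adj (v (N - 1)) (v (m - 1))) (hz : s + 2 ≤ z) (hzN : z < N)
    (hsz : H.Adj (v s) (v z)) (ha : H.Adj (v 0) (v (z - 1))) : False :=
  hH <| hv.hasSpanningCycle
    ((((hv.up (p := z) (q := N - 1) (by omega) (by omega)).append hb
      (hv.down (Nat.zero_le (m - 1)) (by omega))).append ha
      (hv.down (p := s + 1) (q := z - 1) (by omega) (by omega))).append h.symm
      (hv.up (p := m) (q := s) (by omega) (by omega)))
    hsz (by simp; omega) (by intro i hi; simp; omega)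

lemma no_insertion (hv : H.IsSpanningPath N v) (hH : ¬ H.HasSpanningCycle) {s z : ℕ}
    (hs : s + 1 < N) (hz : z + 1 < s) (ha : H.Adj (v 0) (v (s + 1)))
    (hb : H.Adj (v (N - 1)) (v (s - 1))) (h : H.Adj (v s) (v z)) (h' : H.Adj (v s) (v (z + 1))) :
    False :=
  hH <| hv.hasSpanningCycle
    ((((hv.up (Nat.zero_le z) (by omega)).append h.symm
      (hv.up (p := s) (q := s) (by omega) (by omega))).append h'
      (hv.up (p := z + 1) (q := s - 1) (by omega) (by omega))).append hb.symm
      (hv.down (p := s + 1) (q := N - 1) (by omega) (by omega)))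
    ha.symm (by simp; omega) (by intro i hi; simp; omega)

lemma no_successor_chord (hv : H.IsSpanningPath N v) (hH : ¬ H.HasSpanningCycle) {m l : ℕ}
    (hml : m < l) (hl : l + 1 < N) (hb : H.Adj (v (N - 1)) (v m)) (ha : H.Adj (v 0) (v l))
    (h : H.Adj (v (m + 1)) (v (l + 1))) : False :=
  hH <| hv.hasSpanningCycle
    (((hv.up (Nat.zero_le m) (by omega)).append hb.symm
      (hv.down (p := l + 1) (q := N - 1) (by omega) (by omega))).append h.symm
      (hv.up (p := m + 1) (q := l) (by omega) (by omega)))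
    ha.symm (by simp; omega) (by intro i hi; simp; omega)

end SimpleGraph.IsSpanningPath

/-- Toughness up to an additive error `e`, tested on colourings of the vertices outside `S` that
are constant along edges. -/
def SimpleGraph.NearlyTough {α : Type*} (H : SimpleGraph α) (t e : ℕ) : Prop :=
  ∀ (S : Finset α) (f : α → ℕ) (K : Finset ℕ), 2 ≤ K.card →
    (∀ a b, a ∉ S → b ∉ S → H.Adj a b → f a = f b) → (∀ k ∈ K, ∃ a, a ∉ S ∧ f a = k) →
    t * K.card ≤ S.card + e

lemma SimpleGraph.Tough.nearlyTough {V : Type*} [Fintype V] {G : SimpleGraph V} {t : ℕ}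
    (h : SimpleGraph.Tough (t : ℚ) G) : G.NearlyTough t 0 := by
  classical
  intro S f K hK hf hKf
  let g : (G.induce ((↑S : Set V)ᶜ)).ConnectedComponent → ℕ :=
    fun c => c.lift (fun a => f a.1) (by
      intro a b p _
      have key : ∀ (a b : ((↑S : Set V)ᶜ : Set V)), (G.induce ((↑S : Set V)ᶜ)).Walk a b →
          f a.1 = f b.1 := by
        intro a b p
        induction p with
        | nil => rfl
        | @cons x y _ hadj _ ih =>
          rw [← ih]
          exact hf _ _ x.2 y.2 hadj
      exact key a b p)
  have hcard : K.card ≤ Nat.card ((G.induce ((↑S : Set V)ᶜ)).ConnectedComponent) := by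
    have hsub : K ⊆ Finset.univ.image g := by
      intro k hk
      obtain ⟨a, haS, rfl⟩ := hKf k hk
      refine Finset.mem_image.2
        ⟨(G.induce ((↑S : Set V)ᶜ)).connectedComponentMk ⟨a, by simpa using haS⟩, by simp, rfl⟩
    rw [Nat.card_eq_fintype_card]
    exact (Finset.card_le_card hsub).trans Finset.card_image_le
  have h2 := h S (hK.trans hcard)
  have h3 : t * Nat.card ((G.induce ((↑S : Set V)ᶜ)).ConnectedComponent) ≤ S.card := by
    exact_mod_cast h2
  exact (Nat.mul_le_mul_left t hcard).trans h3

namespace SimpleGraph.NearlyTough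

lemma delete_vertex {V : Type*} [DecidableEq V] {G : SimpleGraph V} {t : ℕ}
    (h : G.NearlyTough t 0) {w : V} {H : SimpleGraph {u // u ≠ w}}
    (hGH : ∀ a b : {u // u ≠ w}, G.Adj a b → H.Adj a b) : H.NearlyTough t 1 := by
  intro S f K hK hf hKf
  have hS : ∀ a (ha : a ≠ w), a ∉ insert w (S.map (Function.Embedding.subtype _)) →
      (⟨a, ha⟩ : {u // u ≠ w}) ∉ S := by
    intro a ha haS hmem
    exact haS (Finset.mem_insert_of_mem (Finset.mem_map.2 ⟨⟨a, ha⟩, hmem, rfl⟩))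
  have := h (insert w (S.map (Function.Embedding.subtype _)))
    (fun u => if hu : u ≠ w then f ⟨u, hu⟩ else 0) K hK ?_ ?_
  · refine this.trans ?_
    have := Finset.card_insert_le w (S.map (Function.Embedding.subtype _))
    rw [Finset.card_map] at this
    exact this
  · intro a b ha hb hab
    have ha' : a ≠ w := fun h => ha (by simp [h])
    have hb' : b ≠ w := fun h => hb (by simp [h])
    simp only [ne_eq, ha', not_false_eq_true, ↓reduceDIte, hb']
    exact hf _ _ (hS a ha' ha) (hS b hb' hb) (hGH ⟨a, ha'⟩ ⟨b, hb'⟩ hab)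
  · intro k hk
    obtain ⟨a, haS, rfl⟩ := hKf k hk
    refine ⟨a, ?_, by simp [a.2]⟩
    simp only [Finset.mem_insert, Finset.mem_map, not_or, not_exists, not_and]
    refine ⟨a.2, fun x hx hxa => haS ?_⟩
    rwa [show a = x from (Subtype.ext hxa).symm]

variable {α : Type*} {H : SimpleGraph α} {t e : ℕ}

lemma le_of_separated (h : H.NearlyTough t e) {S : Finset α} (p : α → Prop)
    (hp : ∀ a b, a ∉ S → b ∉ S → p a → ¬ p b → ¬ H.Adj a b) {x y : α} (hx : x ∉ S) (hpx : p x)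
    (hy : y ∉ S) (hpy : ¬ p y) : t * 2 ≤ S.card + e := by
  classical
  refine h S (fun a => if p a then 1 else 0) {0, 1} (by simp) ?_ ?_
  · intro a b ha hb hab
    by_cases hpa : p a <;> by_cases hpb : p b
    · simp [hpa, hpb]
    · exact absurd hab (hp a b ha hb hpa hpb)
    · exact absurd hab.symm (hp b a hb ha hpb hpa)
    · simp [hpa, hpb]
  · intro k hk
    simp only [Finset.mem_insert, Finset.mem_singleton] at hk
    rcases hk with rfl | rfl
    · exact ⟨y, hy, by simp [hpy]⟩
    · exact ⟨x, hx, by simp [hpx]⟩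

variable [DecidableEq α]

/-- The vertices of `I` are isolated after the removal of `S`, and another vertex remains. -/
lemma le_of_isolated (h : H.NearlyTough t e) {I S : Finset α} (hI : I.Nonempty)
    (hIS : ∀ a ∈ I, a ∉ S) (hN : ∀ a ∈ I, ∀ b, H.Adj a b → b ∈ S) {x : α} (hxS : x ∉ S)
    (hxI : x ∉ I) : t * (I.card + 1) ≤ S.card + e := by
  have := h S (fun a => if ha : a ∈ I then (I.equivFin ⟨a, ha⟩ : ℕ) + 1 else 0)
    (Finset.range (I.card + 1)) ?_ ?_ ?_
  · simpa using this
  · have := hI.card_pos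
    simp; omega
  · intro a b ha hb hab
    have ha' : a ∉ I := fun haI => hb (hN a haI b hab)
    have hb' : b ∉ I := fun hbI => ha (hN b hbI a hab.symm)
    simp [ha', hb']
  · intro k hk
    rw [Finset.mem_range] at hk
    rcases k with _ | k
    · exact ⟨x, hxS, by simp [hxI]⟩
    · let a := I.equivFin.symm ⟨k, by omega⟩
      refine ⟨a, hIS _ a.2, ?_⟩
      simp [a]

/-- The vertices of `I` are isolated after the removal of `S`. -/
lemma le_of_isolated' (h : H.NearlyTough t e) {I S : Finset α} (hI : 2 ≤ I.card)
    (hIS : ∀ a ∈ I, a ∉ S) (hN : ∀ a ∈ I, ∀ b, H.Adj a b → b ∈ S) :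
    t * I.card ≤ S.card + e := by
  obtain ⟨x, hx⟩ : I.Nonempty := Finset.card_pos.1 (by omega)
  have hcard := Finset.card_erase_of_mem hx
  have := h.le_of_isolated (I := I.erase x) (S := S) (Finset.card_pos.1 (by omega))
    (fun a ha => hIS a (Finset.mem_of_mem_erase ha))
    (fun a ha => hN a (Finset.mem_of_mem_erase ha)) (hIS x hx) (Finset.notMem_erase x I)
  rwa [hcard, Nat.sub_add_cancel (by omega)] at this

lemma le_degree [Fintype α] [DecidableRel H.Adj] (h : H.NearlyTough t e) {x y : α} (hxy : x ≠ y)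
    (hadj : ¬ H.Adj x y) : t * 2 ≤ H.degree x + e := by
  refine h.le_of_isolated (I := {x}) (S := H.neighborFinset x) (by simp) (by simp) (by simp)
    (x := y) (by simpa using hadj) (by simpa using hxy.symm)

end SimpleGraph.NearlyTough

namespace SimpleGraph.IsSpanningPath

variable {α : Type*} {H : SimpleGraph α} {N : ℕ} {v : ℕ → α}

lemma mem_image_iff [DecidableEq α] (hv : H.IsSpanningPath N v) {P : Finset ℕ}
    (hP : ∀ i ∈ P, i < N) {i : ℕ} (hi : i < N) : v i ∈ P.image v ↔ i ∈ P := by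
  refine ⟨fun h => ?_, Finset.mem_image_of_mem v⟩
  obtain ⟨j, hj, hji⟩ := Finset.mem_image.1 h
  rwa [← hv.inj j i (hP j hj) hi hji]

lemma degree_eq [Fintype α] [DecidableRel H.Adj] (hv : H.IsSpanningPath N v) (x : α) :
    H.degree x = ((Finset.range N).filter fun z => H.Adj x (v z)).card := by
  symm
  rw [← SimpleGraph.card_neighborFinset_eq_degree]
  refine Finset.card_bij (fun z _ => v z) ?_ ?_ ?_
  · intro z hz
    simpa using (Finset.mem_filter.1 hz).2
  · intro z hz z' hz' h
    simp only [Finset.mem_filter, Finset.mem_range] at hz hz'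
    exact hv.inj z z' hz.1 hz'.1 h
  · intro y hy
    obtain ⟨z, hz, rfl⟩ := hv.surj y
    exact ⟨z, by simpa [hz] using hy, rfl⟩

end SimpleGraph.IsSpanningPath

namespace SpanningPath

variable {α : Type*} (H : SimpleGraph α) [DecidableRel H.Adj] (N : ℕ) (v : ℕ → α)

/-- Indices `m` such that the first vertex is adjacent to the successor of `v m`. -/
def leftSet : Finset ℕ := (Finset.range (N - 1)).filter fun m => H.Adj (v 0) (v (m + 1))

/-- Indices `m` such that the last vertex is adjacent to `v m`. -/
def rightSet : Finset ℕ := (Finset.range (N - 1)).filter fun m => H.Adj (v (N - 1)) (v m)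

/-- Indices of path edges that are neither in `leftSet` nor in `rightSet`. -/
def freeSet : Finset ℕ := Finset.range (N - 1) \ (leftSet H N v ∪ rightSet H N v)

/-- Indices `s` in `leftSet` whose predecessor is in `rightSet`. -/
def swapSet : Finset ℕ := (leftSet H N v).filter fun s => 1 ≤ s ∧ s - 1 ∈ rightSet H N v

variable {H N v}

lemma mem_leftSet {m : ℕ} : m ∈ leftSet H N v ↔ m + 1 < N ∧ H.Adj (v 0) (v (m + 1)) := by
  simp only [leftSet, Finset.mem_filter, Finset.mem_range]
  exact and_congr_left fun _ => by omega

lemma mem_rightSet {m : ℕ} : m ∈ rightSet H N v ↔ m + 1 < N ∧ H.Adj (v (N - 1)) (v m) := by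
  simp only [rightSet, Finset.mem_filter, Finset.mem_range]
  exact and_congr_left fun _ => by omega

lemma mem_freeSet {m : ℕ} :
    m ∈ freeSet H N v ↔ m + 1 < N ∧ m ∉ leftSet H N v ∧ m ∉ rightSet H N v := by
  simp only [freeSet, Finset.mem_sdiff, Finset.mem_range, Finset.mem_union, not_or]
  exact and_congr_left fun _ => by omega

lemma mem_swapSet {m : ℕ} :
    m ∈ swapSet H N v ↔ m ∈ leftSet H N v ∧ 1 ≤ m ∧ m - 1 ∈ rightSet H N v := by
  simp [swapSet]

variable (H N v) in
/-- No neighbour of `v s` allows a rotation towards the first vertex. -/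
def Rigid (s : ℕ) : Prop :=
  (∀ z < s, H.Adj (v s) (v z) → z ∉ leftSet H N v) ∧
    ∀ z, s + 2 ≤ z → z < N → H.Adj (v s) (v z) → z - 2 ∉ leftSet H N v

lemma zero_mem_leftSet (hv : H.IsSpanningPath N v)
    (hN : 2 ≤ N) : 0 ∈ leftSet H N v :=
  mem_leftSet.2 ⟨by omega, hv.adj 0 (by omega)⟩

lemma pred_mem_rightSet (hv : H.IsSpanningPath N v)
    (hN : 2 ≤ N) : N - 2 ∈ rightSet H N v := by
  refine mem_rightSet.2 ⟨by omega, ?_⟩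
  have := hv.adj (N - 2) (by omega)
  rw [show N - 2 + 1 = N - 1 by omega] at this
  exact this.symm

lemma not_adj_zero_of_rigid (hv : H.IsSpanningPath N v)
    (hN : 2 ≤ N) {s : ℕ} (hs : 1 ≤ s) (hr : Rigid H N v s) :
    ¬ H.Adj (v s) (v 0) := fun h => hr.1 0 hs h (zero_mem_leftSet hv hN)

lemma notMem_rightSet_of_mem_leftSet (hv : H.IsSpanningPath N v) (hH : ¬ H.HasSpanningCycle)
    {m : ℕ} (hm : m ∈ leftSet H N v) : m ∉ rightSet H N v := by
  intro hb
  exact hv.no_crossing hH (mem_leftSet.1 hm).1 (mem_leftSet.1 hm).2 (mem_rightSet.1 hb).2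

lemma left_pattern (hv : H.IsSpanningPath N v) (hH : ¬ H.HasSpanningCycle)
    {s z : ℕ} (hs : s ∈ leftSet H N v) (hr : Rigid H N v s) (hz : z < s)
    (hadj : H.Adj (v s) (v z)) :
    z ∈ freeSet H N v ∨ z + 1 ∈ freeSet H N v ∪ swapSet H N v := by
  have hsN := (mem_leftSet.1 hs).1
  have hzA := hr.1 z hz hadj
  by_cases hzB : z ∈ rightSet H N v
  · right
    rw [Finset.mem_union, mem_freeSet, mem_swapSet]
    by_cases hA : z + 1 ∈ leftSet H N v
    · exact Or.inr ⟨hA, by omega, by simpa using hzB⟩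
    · refine Or.inl ⟨by omega, hA, fun hB => ?_⟩
      exact hv.no_chord_of_right_left hH hz hsN hadj.symm (mem_leftSet.1 hs).2
        (mem_rightSet.1 hB).2
  · exact Or.inl (mem_freeSet.2 ⟨by omega, hzA, hzB⟩)

lemma right_pattern (hv : H.IsSpanningPath N v) (hH : ¬ H.HasSpanningCycle)
    {s z : ℕ} (hs : s ∈ leftSet H N v) (hr : Rigid H N v s) (hz : s + 2 ≤ z)
    (hzN : z < N) (hadj : H.Adj (v s) (v z)) :
    z - 1 ∈ freeSet H N v ∪ swapSet H N v ∨ z - 2 ∈ freeSet H N v := by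
  have hzA := hr.2 z hz hzN hadj
  by_cases hzB : z - 2 ∈ rightSet H N v
  · left
    rw [Finset.mem_union, mem_freeSet, mem_swapSet]
    by_cases hA : z - 1 ∈ leftSet H N v
    · exact Or.inr ⟨hA, by omega, hzB⟩
    · refine Or.inl ⟨by omega, hA, fun hB => ?_⟩
      exact hv.no_chord_of_left_right hH hz hzN hadj (mem_leftSet.1 hs).2 (mem_rightSet.1 hB).2
  · exact Or.inr (mem_freeSet.2 ⟨by omega, hzA, hzB⟩)

lemma rigid_of_mem_swapSet (hv : H.IsSpanningPath N v) (hH : ¬ H.HasSpanningCycle)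
    {s : ℕ} (hs : s ∈ swapSet H N v) : Rigid H N v s := by
  obtain ⟨hA, h1, hB⟩ := mem_swapSet.1 hs
  have hsN := (mem_leftSet.1 hA).1
  refine ⟨fun z hz hadj hzA => ?_, fun z hz hzN hadj hzA => ?_⟩
  · rcases Nat.lt_or_ge (z + 1) s with h | h
    · exact hv.no_chord_of_left_right hH h (by omega) hadj.symm (mem_leftSet.1 hzA).2
        (mem_rightSet.1 hB).2
    · obtain rfl : z = s - 1 := by omega
      exact notMem_rightSet_of_mem_leftSet hv hH hzA hB
  · have hadj' := hv.adj (z - 2) (by omega)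
    refine hv.no_left_neighbor hH h1 (m := s) (s := z - 1) (z := z - 2) (by omega) (by omega) ?_
      (mem_rightSet.1 hB).2 (by omega) ?_ (mem_leftSet.1 hzA).2
    · rwa [show z - 1 + 1 = z by omega]
    · rw [show z - 1 = z - 2 + 1 by omega]
      exact hadj'.symm

lemma degree_le_of_mem_swapSet [Fintype α] (hv : H.IsSpanningPath N v) (hH : ¬ H.HasSpanningCycle)
    {s : ℕ} (hs : s ∈ swapSet H N v) :
    H.degree (v s) ≤ (freeSet H N v).card + (swapSet H N v).card + 1 := by
  have hr := rigid_of_mem_swapSet hv hH hs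
  obtain ⟨hA, h1, hB⟩ := mem_swapSet.1 hs
  obtain ⟨hsN, hsA⟩ := mem_leftSet.1 hA
  have hsU : s ∉ freeSet H N v := fun h => (mem_freeSet.1 h).2.1 hA
  rw [hv.degree_eq]
  set D := (Finset.range N).filter fun z => H.Adj (v s) (v z) with hD
  have hDmem : ∀ z ∈ D.erase (s + 1), z < N ∧ H.Adj (v s) (v z) ∧ (z < s ∨ s + 2 ≤ z) := by
    intro z hz
    simp only [hD, Finset.mem_erase, Finset.mem_filter, Finset.mem_range] at hz
    refine ⟨hz.2.1, hz.2.2, ?_⟩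
    have : z ≠ s := by rintro rfl; exact hz.2.2.ne rfl
    omega
  have hle : (D.erase (s + 1)).card ≤ (freeSet H N v ∪ swapSet H N v).card := by
    refine Finset.card_le_card_of_injOn (fun z => if z < s then
      (if z ∈ freeSet H N v then z else z + 1) else
      (if z - 1 ∈ freeSet H N v ∪ swapSet H N v then z - 1 else z - 2)) ?_ ?_
    · intro z hz
      obtain ⟨hzN, hadj, h | h⟩ := hDmem z hz
      · have := left_pattern hv hH hA hr h hadj
        simp only [h, if_true]
        split_ifs with h'
        · exact Finset.mem_union_left _ h'
        · exact this.resolve_left h'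
      · have := right_pattern hv hH hA hr h hzN hadj
        simp only [show ¬ z < s by omega, if_false]
        split_ifs with h'
        · exact h'
        · exact Finset.mem_union_left _ (this.resolve_left h')
    · have hleft : ∀ z, z + 1 < s → H.Adj (v s) (v z) → H.Adj (v s) (v (z + 1)) → False :=
        fun z hz h h' => hv.no_insertion hH hsN hz hsA (mem_rightSet.1 hB).2 h h'
      have hright : ∀ z, s + 2 ≤ z → z + 1 < N → H.Adj (v s) (v z) → H.Adj (v s) (v (z + 1)) →
          False := fun z hz hzN h h' => hv.no_left_neighbor hH h1 (m := s) (s := z) (z := s)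
            (by omega) hzN h' (mem_rightSet.1 hB).2 (by omega) h.symm hsA
      intro z hz z' hz' hzz
      obtain ⟨hzN, hadj, h⟩ := hDmem z hz
      obtain ⟨hzN', hadj', h'⟩ := hDmem z' hz'
      have hside : ∀ y, s + 2 ≤ y → y < N → H.Adj (v s) (v y) →
          ¬ (y - 1 ∈ freeSet H N v ∪ swapSet H N v) → s + 2 < y := by
        intro y hy hyN hya hyn
        have := (right_pattern hv hH hA hr hy hyN hya).resolve_left hyn
        by_contra hcon
        rw [show y - 2 = s by omega] at this
        exact hsU this
      have e1 := hside z
      have e2 := hside z'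
      have a1 := hleft z
      have a2 := hleft z'
      have a3 := hright z
      have a4 := hright z'
      dsimp only at hzz
      by_contra hne
      rcases h with h | h <;> rcases h' with h' | h'
      · simp only [h, h', if_true] at hzz
        split_ifs at hzz
        · exact hne hzz
        · subst hzz
          exact a2 h hadj' hadj
        · subst hzz
          exact a1 h' hadj hadj'
        · omega
      · simp only [h, if_true, show ¬ z' < s by omega, if_false] at hzz
        split_ifs at hzz with c1 c2 c2
        · omega
        · omega
        · omega
        · have := e2 h' hzN' hadj' c2
          omega
      · simp only [h', if_true, show ¬ z < s by omega, if_false] at hzz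
        split_ifs at hzz with c1 c2 c2
        · omega
        · omega
        · have := e1 h hzN hadj c1
          omega
        · have := e1 h hzN hadj c1
          omega
      · simp only [show ¬ z < s by omega, show ¬ z' < s by omega, if_false] at hzz
        split_ifs at hzz
        · omega
        · obtain rfl : z' = z + 1 := by omega
          exact a3 h hzN' hadj hadj'
        · obtain rfl : z = z' + 1 := by omega
          exact a4 h' hzN hadj' hadj
        · omega
  have h3 := Finset.card_union_le (freeSet H N v) (swapSet H N v)
  have h4 := Finset.pred_card_le_card_erase (s := D) (a := s + 1)
  omega

section

variable [Fintype α]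

lemma card_leftSet (hv : H.IsSpanningPath N v) : (leftSet H N v).card = H.degree (v 0) := by
  rw [hv.degree_eq]
  refine Finset.card_bij (fun z _ => z + 1) ?_ ?_ ?_
  · intro z hz
    simpa using mem_leftSet.1 hz
  · intro z _ z' _ h
    simpa using h
  · intro z hz
    simp only [Finset.mem_filter, Finset.mem_range] at hz
    rcases z with _ | z
    · exact absurd hz.2 (H.loopless.irrefl _)
    · exact ⟨z, mem_leftSet.2 hz, rfl⟩

lemma card_rightSet (hv : H.IsSpanningPath N v) :
    (rightSet H N v).card = H.degree (v (N - 1)) := by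
  rw [hv.degree_eq]
  congr 1
  ext z
  simp only [mem_rightSet, Finset.mem_filter, Finset.mem_range]
  refine ⟨fun h => ⟨by omega, h.2⟩, fun h => ⟨?_, h.2⟩⟩
  have : z ≠ N - 1 := by
    rintro rfl
    exact H.loopless.irrefl _ h.2
  omega

lemma card_freeSet (hv : H.IsSpanningPath N v) (hH : ¬ H.HasSpanningCycle) :
    (freeSet H N v).card + H.degree (v 0) + H.degree (v (N - 1)) = N - 1 := by
  rw [← card_leftSet hv, ← card_rightSet hv, freeSet, add_assoc, ← Finset.card_union_of_disjoint,
    Finset.card_sdiff_add_card_eq_card, Finset.card_range]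
  · exact Finset.union_subset (Finset.filter_subset _ _) (Finset.filter_subset _ _)
  · exact Finset.disjoint_left.2 fun m hm => notMem_rightSet_of_mem_leftSet hv hH hm

end

/-- The independent set of swap vertices has few neighbours. -/
lemma tough_le_of_swapSet_nonempty [Finite α] {t : ℕ} (hv : H.IsSpanningPath N v)
    (hH : ¬ H.HasSpanningCycle) (ht : H.NearlyTough t 1) (hN : 2 ≤ N)
    (hW : (swapSet H N v).Nonempty) :
    t * ((swapSet H N v).card + 1) ≤ 2 * (swapSet H N v).card + 4 * (freeSet H N v).card + 1 := by
  classical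
  have := Fintype.ofFinite α
  set W := swapSet H N v with hWdef
  set U := freeSet H N v with hUdef
  have hWN : ∀ s ∈ W, s + 1 < N := fun s hs => (mem_leftSet.1 (mem_swapSet.1 hs).1).1
  set P : Finset ℕ := W.image (· + 1) ∪ (W.image (· - 1) ∪ (U ∪ (U.image (· - 1) ∪
    (U.image (· + 1) ∪ U.image (· + 2)))))
  have hP : P.card ≤ 2 * W.card + 4 * U.card := by
    have h1 : P.card ≤ _ := Finset.card_union_le (W.image (· + 1)) (W.image (· - 1) ∪
      (U ∪ (U.image (· - 1) ∪ (U.image (· + 1) ∪ U.image (· + 2)))))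
    have h2 := Finset.card_union_le (W.image (· - 1)) (U ∪ (U.image (· - 1) ∪
      (U.image (· + 1) ∪ U.image (· + 2))))
    have h3 := Finset.card_union_le U (U.image (· - 1) ∪ (U.image (· + 1) ∪ U.image (· + 2)))
    have h4 := Finset.card_union_le (U.image (· - 1)) (U.image (· + 1) ∪ U.image (· + 2))
    have h5 := Finset.card_union_le (U.image (· + 1)) (U.image (· + 2))
    have := Finset.card_image_le (s := W) (f := (· + 1))
    have := Finset.card_image_le (s := W) (f := (· - 1))
    have := Finset.card_image_le (s := U) (f := (· - 1))
    have := Finset.card_image_le (s := U) (f := (· + 1))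
    have := Finset.card_image_le (s := U) (f := (· + 2))
    omega
  have hind : ∀ s ∈ W, ∀ s' ∈ W, ¬ H.Adj (v s) (v s') := by
    have key : ∀ s ∈ W, ∀ s' ∈ W, s < s' → ¬ H.Adj (v s) (v s') := fun s hs s' hs' hlt h =>
      (rigid_of_mem_swapSet hv hH hs').1 s hlt h.symm (mem_swapSet.1 hs).1
    intro s hs s' hs' h
    rcases lt_trichotomy s s' with hlt | rfl | hlt
    · exact key s hs s' hs' hlt h
    · exact H.loopless.irrefl _ h
    · exact key s' hs' s hs hlt h.symm
  set S := (W.image v).biUnion fun x => H.neighborFinset x with hSdef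
  have hmemS : ∀ x, x ∈ S ↔ ∃ s ∈ W, H.Adj (v s) x := by
    intro x
    simp [hSdef]
  have hSP : S ⊆ P.image v := by
    intro x hx
    obtain ⟨s, hs, hadj⟩ := (hmemS x).1 hx
    obtain ⟨z, hzN, rfl⟩ := hv.surj x
    refine Finset.mem_image_of_mem v ?_
    have hr := rigid_of_mem_swapSet hv hH hs
    obtain ⟨hA, -, -⟩ := mem_swapSet.1 hs
    have im : ∀ (T : Finset ℕ) (f : ℕ → ℕ) (y w : ℕ), y ∈ T → f y = w → w ∈ T.image f :=
      fun T f y w hy hw => Finset.mem_image.2 ⟨y, hy, hw⟩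
    simp only [P, Finset.mem_union]
    rcases lt_trichotomy z s with h | rfl | h
    · rcases left_pattern hv hH hA hr h hadj with h' | h'
      · exact Or.inr (Or.inr (Or.inl h'))
      · rcases Finset.mem_union.1 h' with h' | h'
        · exact Or.inr (Or.inr (Or.inr (Or.inl (im _ _ (z + 1) z h' (by simp)))))
        · exact Or.inr (Or.inl (im _ _ (z + 1) z h' (by simp)))
    · exact absurd hadj (H.loopless.irrefl _)
    · rcases Nat.lt_or_ge z (s + 2) with h2 | h2
      · exact Or.inl (im _ _ s z hs (by omega))
      · rcases right_pattern hv hH hA hr h2 hzN hadj with h' | h'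
        · rcases Finset.mem_union.1 h' with h' | h'
          · exact Or.inr (Or.inr (Or.inr (Or.inr (Or.inl (im _ _ (z - 1) z h' (by omega))))))
          · exact Or.inl (im _ _ (z - 1) z h' (by omega))
        · exact Or.inr (Or.inr (Or.inr (Or.inr (Or.inr (im _ _ (z - 2) z h' (by omega))))))
  have hcard : (W.image v).card = W.card := by
    refine Finset.card_image_of_injOn fun s hs s' hs' h => ?_
    exact hv.inj s s' (by have := hWN s hs; omega) (by have := hWN s' hs'; omega) h
  have := ht.le_of_isolated (I := W.image v) (S := S) (hW.image v) ?_ ?_ (x := v 0) ?_ ?_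
  · rw [hcard] at this
    have := (Finset.card_le_card hSP).trans Finset.card_image_le
    omega
  · intro a ha haS
    obtain ⟨s', hs', rfl⟩ := Finset.mem_image.1 ha
    obtain ⟨s, hs, hadj⟩ := (hmemS _).1 haS
    exact hind s hs s' hs' hadj
  · intro a ha b hab
    obtain ⟨s, hs, rfl⟩ := Finset.mem_image.1 ha
    exact (hmemS b).2 ⟨s, hs, hab⟩
  · intro h0
    obtain ⟨s, hs, hadj⟩ := (hmemS _).1 h0
    exact not_adj_zero_of_rigid hv hN (mem_swapSet.1 hs).2.1 (rigid_of_mem_swapSet hv hH hs) hadj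
  · intro h0
    obtain ⟨s, hs, hs0⟩ := Finset.mem_image.1 h0
    have := hWN s hs
    have := hv.inj s 0 (by omega) (by omega) hs0
    have := (mem_swapSet.1 hs).2.1
    omega

lemma degree_le_of_rigid [Fintype α] (hv : H.IsSpanningPath N v) (hH : ¬ H.HasSpanningCycle)
    (hW : swapSet H N v = ∅) {s : ℕ} (hA : s ∈ leftSet H N v) (hr : Rigid H N v s) :
    H.degree (v s) ≤ 2 * (freeSet H N v).card + 1 := by
  obtain ⟨hsN, hsA⟩ := mem_leftSet.1 hA
  have hsU : s ∉ freeSet H N v := fun h => (mem_freeSet.1 h).2.1 hA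
  set T := (freeSet H N v).biUnion fun c => if c < s then {c, c - 1} else {c + 1, c + 2} with hT
  have hTcard : T.card ≤ (freeSet H N v).card * 2 := by
    refine Finset.card_biUnion_le_card_mul _ _ _ fun c _ => ?_
    split_ifs <;> exact Finset.card_le_two
  have hsub : (Finset.range N).filter (fun z => H.Adj (v s) (v z)) ⊆ insert (s + 1) T := by
    intro z hz
    simp only [Finset.mem_filter, Finset.mem_range] at hz
    obtain ⟨hzN, hadj⟩ := hz
    have hzs : z ≠ s := by rintro rfl; exact hadj.ne rfl
    rw [Finset.mem_insert, or_iff_not_imp_left]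
    intro hzs1
    rw [hT, Finset.mem_biUnion]
    rcases Nat.lt_or_ge z s with h | h
    · have hp := left_pattern hv hH hA hr h hadj
      rw [hW, Finset.union_empty] at hp
      rcases hp with hp | hp
      · exact ⟨z, hp, by simp [h]⟩
      · have : z + 1 ≠ s := by rintro rfl; exact hsU hp
        exact ⟨z + 1, hp, by rw [if_pos (by omega)]; simp⟩
    · have hp := right_pattern hv hH hA hr (z := z) (by omega) hzN hadj
      rw [hW, Finset.union_empty] at hp
      rcases hp with hp | hp
      · refine ⟨z - 1, hp, ?_⟩
        rw [if_neg (by omega), Finset.mem_insert]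
        left; omega
      · refine ⟨z - 2, hp, ?_⟩
        rw [if_neg (by omega), Finset.mem_insert, Finset.mem_singleton]
        right; omega
  rw [hv.degree_eq]
  have := (Finset.card_le_card hsub).trans (Finset.card_insert_le _ _)
  omega

/-- If no vertex of `leftSet` is rigid, a small set separates the two ends of the path. -/
lemma tough_le_of_not_rigid [Finite α] {t : ℕ} (hv : H.IsSpanningPath N v)
    (hH : ¬ H.HasSpanningCycle) (ht : H.NearlyTough t 1) (hN : 2 ≤ N)
    (hW : swapSet H N v = ∅) (hr : ∀ s ∈ leftSet H N v, 1 ≤ s → ¬ Rigid H N v s) :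
    t * 2 ≤ 2 * (freeSet H N v).card + 2 := by
  classical
  have := Fintype.ofFinite α
  set A := leftSet H N v with hA
  set B := rightSet H N v with hB
  set U := freeSet H N v with hU
  set B' := B.image (· + 1) with hB'
  have memB' : ∀ m, m ∈ B' ↔ 1 ≤ m ∧ m - 1 ∈ B := by
    intro m
    rw [hB', Finset.mem_image]
    constructor
    · rintro ⟨c, hc, rfl⟩
      exact ⟨by omega, by simpa using hc⟩
    · rintro ⟨h1, h2⟩
      exact ⟨m - 1, h2, by omega⟩
  have hAB' : ∀ m ∈ A, m ∉ B' := by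
    intro m hm hm'
    have : m ∈ swapSet H N v := mem_swapSet.2 ⟨hm, (memB' m).1 hm'⟩
    simp [hW] at this
  have hAN : ∀ m ∈ A, m + 1 < N := fun m hm => (mem_leftSet.1 hm).1
  have hB'N : ∀ m ∈ B', m < N := fun m hm => by
    have := (mem_rightSet.1 ((memB' m).1 hm).2).1
    omega
  set C := Finset.range N \ (A ∪ B') with hC
  have hCcard : C.card = U.card + 1 := by
    have h1 : C.card + (A ∪ B').card = (Finset.range N).card := by
      refine Finset.card_sdiff_add_card_eq_card (Finset.union_subset ?_ ?_)
      · intro m hm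
        have := hAN m hm
        rw [Finset.mem_range]; omega
      · intro m hm
        exact Finset.mem_range.2 (hB'N m hm)
    rw [Finset.card_union_of_disjoint (Finset.disjoint_left.2 hAB'),
      Finset.card_image_of_injective _ (add_left_injective 1), card_leftSet hv, card_rightSet hv,
      Finset.card_range] at h1
    have : U.card + _ + _ = N - 1 := card_freeSet hv hH
    omega
  set Bad := A.filter fun l => ∃ m ∈ B', m < l ∧ H.Adj (v m) (v l) with hBad
  have hBadcard : Bad.card ≤ U.card := by
    have hpos : ∀ l ∈ Bad, 2 ≤ l := by
      intro l hl
      obtain ⟨-, m, hm, hml, -⟩ := Finset.mem_filter.1 hl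
      have := ((memB' m).1 hm).1
      omega
    refine Finset.card_le_card_of_injOn (fun l => l - 1) ?_ ?_
    · intro l hl
      have hl2 := hpos l hl
      obtain ⟨hlA, m, hm, hml, hadj⟩ := Finset.mem_filter.1 hl
      obtain ⟨hm1, hmB⟩ := (memB' m).1 hm
      have hlN := hAN l hlA
      refine mem_freeSet.2 ⟨by dsimp; omega, fun h => ?_, fun h => hAB' l hlA ?_⟩
      · have hne : m ≠ l - 1 := by rintro rfl; exact hAB' _ h hm
        have hadj' : H.Adj (v m) (v (l - 1 + 1)) := by rwa [show l - 1 + 1 = l by omega]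
        refine hr (l - 1) h (by omega) ⟨fun z hz hz' hzA => ?_, fun z hz hzN hz' hzA => ?_⟩
        · exact hv.no_left_neighbor hH hm1 (s := l - 1) (z := z) (by omega) (by omega) hadj'
            (mem_rightSet.1 hmB).2 hz hz' (mem_leftSet.1 hzA).2
        · refine hv.no_right_neighbor hH hm1 (s := l - 1) (z := z) (by omega) hadj'
            (mem_rightSet.1 hmB).2 hz hzN hz' ?_
          have := (mem_leftSet.1 hzA).2
          rwa [show z - 2 + 1 = z - 1 by omega] at this
      · exact (memB' l).2 ⟨by omega, h⟩
    · intro l hl l' hl' h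
      have h1 := hpos l hl
      have h2 := hpos l' hl'
      dsimp only at h
      omega
  have hSN : ∀ i ∈ C ∪ Bad, i < N := by
    intro i hi
    rcases Finset.mem_union.1 hi with hi | hi
    · exact Finset.mem_range.1 (Finset.mem_sdiff.1 hi).1
    · have := hAN i (Finset.mem_filter.1 hi).1
      omega
  have hzero : 0 ∈ A := zero_mem_leftSet hv hN
  have hlast : N - 1 ∈ B' := (memB' _).2 ⟨by omega, pred_mem_rightSet hv hN⟩
  have := ht.le_of_separated (S := (C ∪ Bad).image v) (fun x => ∃ i ∈ A, v i = x)
    ?_ (x := v 0) (y := v (N - 1)) ?_ ⟨0, hzero, rfl⟩ ?_ ?_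
  · have h1 := Finset.card_image_le (s := C ∪ Bad) (f := v)
    have h2 := Finset.card_union_le C Bad
    omega
  · rintro _ b ha hb ⟨i, hi, rfl⟩ hpb hadj
    obtain ⟨j, hj, rfl⟩ := hv.surj b
    have hiN := hAN i hi
    rw [hv.mem_image_iff hSN (by omega)] at ha hb
    have hjA : j ∉ A := fun h => hpb ⟨j, h, rfl⟩
    have hjB : j ∈ B' := by
      by_contra h
      exact hb (Finset.mem_union_left _ (by simp [hC, hj, hjA, h]))
    obtain ⟨hj1, hjB1⟩ := (memB' j).1 hjB
    rcases lt_trichotomy j i with h | rfl | h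
    · exact ha (Finset.mem_union_right _ (Finset.mem_filter.2 ⟨hi, j, hjB, h, hadj.symm⟩))
    · exact hjA hi
    · rcases Nat.lt_or_ge (i + 1) j with h' | h'
      · exact hv.no_chord_of_left_right hH h' hj hadj (mem_leftSet.1 hi).2 (mem_rightSet.1 hjB1).2
      · obtain rfl : j = i + 1 := by omega
        exact notMem_rightSet_of_mem_leftSet hv hH hi hjB1
  · rw [hv.mem_image_iff hSN (by omega)]
    simp [hC, hBad, hzero]
  · rw [hv.mem_image_iff hSN (by omega)]
    have : N - 1 ∉ A := fun h => hAB' _ h hlast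
    simp [hC, hBad, hlast, this]
  · rintro ⟨i, hi, h⟩
    have h1 := hAN i hi
    have := hv.inj i (N - 1) (by omega) (by omega) h
    omega

/-- The ends of a spanning path in a nearly tough graph without spanning cycle have a small degree
sum. -/
theorem degree_add_degree_lt [Fintype α] {t : ℕ} (ht4 : 4 ≤ t) (hv : H.IsSpanningPath N v)
    (hH : ¬ H.HasSpanningCycle) (ht : H.NearlyTough t 1) (hN : 2 ≤ N) :
    2 * (H.degree (v 0) + H.degree (v (N - 1))) + t + 2 < 2 * N := by
  classical
  have hcard := card_freeSet hv hH
  by_contra hcon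
  have hu : 2 * (freeSet H N v).card ≤ t := by omega
  have hdeg : ∀ s ∈ leftSet H N v, 1 ≤ s → Rigid H N v s → t * 2 ≤ H.degree (v s) + 1 := by
    intro s hs h1 hr
    have hsN := (mem_leftSet.1 hs).1
    refine ht.le_degree (y := v 0) (fun h => ?_) (not_adj_zero_of_rigid hv hN h1 hr)
    have := hv.inj s 0 (by omega) (by omega) h
    omega
  rcases (swapSet H N v).eq_empty_or_nonempty with hW | hW
  · by_cases hr : ∀ s ∈ leftSet H N v, 1 ≤ s → ¬ Rigid H N v s
    · have := tough_le_of_not_rigid hv hH ht hN hW hr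
      omega
    · push Not at hr
      obtain ⟨s, hs, h1, hrs⟩ := hr
      have h2 := hdeg s hs h1 hrs
      have h3 := degree_le_of_rigid hv hH hW hs hrs
      omega
  · have h1 := tough_le_of_swapSet_nonempty hv hH ht hN hW
    obtain ⟨s, hs⟩ := hW
    have h2 := degree_le_of_mem_swapSet hv hH hs
    have h3 := hdeg s (mem_swapSet.1 hs).1 (mem_swapSet.1 hs).2.1 (rigid_of_mem_swapSet hv hH hs)
    have h4 : t ≤ (swapSet H N v).card := by omega
    nlinarith

end SpanningPath

namespace SimpleGraph

variable {α : Type*} [Fintype α] {H : SimpleGraph α}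

/-- The successors on a spanning path of the vertices of a universal set are independent. -/
lemma tough_le_of_universal {N t : ℕ} {v : ℕ → α} (hv : H.IsSpanningPath N v)
    (hH : ¬ H.HasSpanningCycle) (ht : H.NearlyTough t 1) (hN : 2 ≤ N) (hcard : Fintype.card α = N)
    {Ω : Finset α} (hΩ : ∀ o ∈ Ω, ∀ z, z ≠ o → H.Adj o z) (hne : Ω.Nonempty) :
    t * (Ω.card + 1) ≤ N - Ω.card := by
  classical
  have hlast : ∀ m, m < N → v m ∈ Ω → m + 1 < N := by
    intro m hm hmΩ
    by_contra hcon
    obtain rfl : m = N - 1 := by omega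
    have hne : v 0 ≠ v (N - 1) := fun h => by
      have := hv.inj 0 (N - 1) (by omega) (by omega) h
      omega
    have h1 := hv.adj (N - 2) (by omega)
    have h2 := hΩ _ hmΩ (v 0) hne
    rw [show N - 2 + 1 = N - 1 by omega] at h1
    refine hv.no_crossing hH (m := N - 2) (by omega) ?_ h1.symm
    rw [show N - 2 + 1 = N - 1 by omega]
    exact h2.symm
  have hb : ∀ m, m + 1 < N → v m ∈ Ω → H.Adj (v (N - 1)) (v m) := by
    intro m hm hmΩ
    refine (hΩ _ hmΩ _ fun h => ?_).symm
    have := hv.inj (N - 1) m (by omega) (by omega) h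
    omega
  have ha : ∀ l, 0 < l → l < N → v l ∈ Ω → H.Adj (v 0) (v l) := by
    intro l hl hlN hlΩ
    refine (hΩ _ hlΩ _ fun h => ?_).symm
    have := hv.inj 0 l (by omega) (by omega) h
    omega
  set M := (Finset.range N).filter fun m => v m ∈ Ω with hM
  have hMmem : ∀ m, m ∈ M ↔ m < N ∧ v m ∈ Ω := by simp [hM]
  have hMcard : M.card = Ω.card := by
    refine Finset.card_bij (fun m _ => v m) ?_ ?_ ?_
    · intro m hm
      exact ((hMmem m).1 hm).2
    · intro m hm m' hm' h
      exact hv.inj m m' ((hMmem m).1 hm).1 ((hMmem m').1 hm').1 h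
    · intro o ho
      obtain ⟨m, hm, rfl⟩ := hv.surj o
      exact ⟨m, (hMmem m).2 ⟨hm, ho⟩, rfl⟩
  set Q := insert 0 (M.image (· + 1)) with hQ
  have hQcard : Q.card = Ω.card + 1 := by
    rw [hQ, Finset.card_insert_of_notMem (by simp),
      Finset.card_image_of_injective _ (add_left_injective 1), hMcard]
  have hQmem : ∀ q ∈ Q, q = 0 ∨ ∃ m, q = m + 1 ∧ m + 1 < N ∧ v m ∈ Ω := by
    intro q hq
    rcases Finset.mem_insert.1 hq with rfl | hq
    · exact Or.inl rfl
    · obtain ⟨m, hm, rfl⟩ := Finset.mem_image.1 hq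
      obtain ⟨h1, h2⟩ := (hMmem m).1 hm
      exact Or.inr ⟨m, rfl, hlast m h1 h2, h2⟩
  have hQN : ∀ q ∈ Q, q < N := by
    intro q hq
    rcases hQmem q hq with rfl | ⟨m, rfl, h, -⟩
    · omega
    · exact h
  have hlt : ∀ q ∈ Q, ∀ q' ∈ Q, q < q' → ¬ H.Adj (v q) (v q') := by
    intro q hq q' hq' hlt hadj
    rcases hQmem q' hq' with rfl | ⟨l, rfl, hl, hlΩ⟩
    · omega
    · rcases hQmem q hq with rfl | ⟨m, rfl, hm, hmΩ⟩
      · exact hv.no_crossing hH hl hadj (hb l hl hlΩ)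
      · exact hv.no_successor_chord hH (by omega) hl (hb m hm hmΩ)
          (ha l (by omega) (by omega) hlΩ) hadj
  have hind : ∀ q ∈ Q, ∀ q' ∈ Q, ¬ H.Adj (v q) (v q') := by
    intro q hq q' hq' hadj
    rcases lt_trichotomy q q' with h | rfl | h
    · exact hlt q hq q' hq' h hadj
    · exact H.loopless.irrefl _ hadj
    · exact hlt q' hq' q hq h hadj.symm
  have hIcard : (Q.image v).card = Ω.card + 1 := by
    rw [← hQcard]
    exact Finset.card_image_of_injOn fun q hq q' hq' h => hv.inj q q' (hQN q hq) (hQN q' hq') h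
  have hScard := Finset.card_compl_add_card (Q.image v)
  have hpos := hne.card_pos
  have := ht.le_of_isolated' (I := Q.image v) (S := (Q.image v)ᶜ) (by omega) (by simp) ?_
  · rw [hIcard] at this hScard
    omega
  · intro a ha b hab
    obtain ⟨q, hq, rfl⟩ := Finset.mem_image.1 ha
    rw [Finset.mem_compl]
    intro hb
    obtain ⟨q', hq', rfl⟩ := Finset.mem_image.1 hb
    exact hind q hq q' hq' hab

variable [DecidableRel H.Adj]

lemma card_nonadj_add_degree [DecidableEq α] (y : α) :
    (Finset.univ.filter fun u => u ≠ y ∧ ¬ H.Adj y u).card + H.degree y + 1 = Fintype.card α := by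
  have h1 : (Finset.univ.filter fun u => u ≠ y ∧ ¬ H.Adj y u) =
      Finset.univ \ insert y (H.neighborFinset y) := by
    ext u
    simp
  have h2 : (insert y (H.neighborFinset y)).card = H.degree y + 1 := by
    rw [Finset.card_insert_of_notMem (by simp), SimpleGraph.card_neighborFinset_eq_degree]
  rw [h1, add_assoc, ← h2, Finset.card_sdiff_add_card_eq_card (Finset.subset_univ _),
    Finset.card_univ]

lemma exists_nonadj_of_degree_lt {y : α} (h : H.degree y + 1 < Fintype.card α) :
    ∃ u, u ≠ y ∧ ¬ H.Adj y u := by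
  classical
  have := card_nonadj_add_degree (H := H) y
  obtain ⟨u, hu⟩ := (Finset.card_pos (s := Finset.univ.filter fun u => u ≠ y ∧ ¬ H.Adj y u)).1
    (by omega)
  exact ⟨u, (Finset.mem_filter.1 hu).2⟩

/-- If every non-neighbour of `y` has degree at most `k`, then many vertices do. -/
lemma card_le_card_degree_le {y : α} {k : ℕ}
    (h : ∀ u, u ≠ y → ¬ H.Adj y u → H.degree u ≤ k) :
    Fintype.card α ≤ (Finset.univ.filter fun u => H.degree u ≤ k).card + H.degree y + 1 := by
  classical
  rw [← card_nonadj_add_degree (H := H) y]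
  have : (Finset.univ.filter fun u => u ≠ y ∧ ¬ H.Adj y u) ⊆
      Finset.univ.filter fun u => H.degree u ≤ k := by
    intro u hu
    simp only [Finset.mem_filter, Finset.mem_univ, true_and] at hu ⊢
    exact h u hu.1 hu.2
  have := Finset.card_le_card this
  omega

/-- A large set of vertices of degree at most `D` contains a large independent set with few
neighbours. -/
lemma tough_le_of_low_degrees {t D : ℕ} (ht : H.NearlyTough t 1) {P Ω : Finset α}
    (hΩ : ∀ p ∈ P, ∀ o ∈ Ω, H.Adj p o) (hP : ∀ p ∈ P, H.degree p ≤ D)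
    (hcard : D + 2 ≤ P.card) :
    ∃ i, P.card ≤ i * (D - Ω.card + 1) ∧ t * i ≤ Ω.card + i * (D - Ω.card) + 1 ∧
      Ω.card ≤ D := by
  classical
  obtain ⟨I, hI, hmax⟩ := Finset.exists_max_image
    (P.powerset.filter fun I => ∀ x ∈ I, ∀ y ∈ I, ¬ H.Adj x y) Finset.card
    ⟨∅, by simp⟩
  obtain ⟨hIP, hind⟩ := Finset.mem_filter.1 hI
  rw [Finset.mem_powerset] at hIP
  have hΩN : ∀ p ∈ P, Ω ⊆ H.neighborFinset p := fun p hp o ho => by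
    simpa using hΩ p hp o ho
  have hNcard : ∀ p ∈ P, (H.neighborFinset p \ Ω).card ≤ D - Ω.card := by
    intro p hp
    have := hP p hp
    rw [Finset.card_sdiff_of_subset (hΩN p hp), SimpleGraph.card_neighborFinset_eq_degree]
    omega
  obtain ⟨p₀, hp₀⟩ : P.Nonempty := Finset.card_pos.1 (by omega)
  have hΩD : Ω.card ≤ D := by
    have h1 := Finset.card_le_card (hΩN p₀ hp₀)
    rw [SimpleGraph.card_neighborFinset_eq_degree] at h1
    exact h1.trans (hP p₀ hp₀)
  set T := I.biUnion fun p => H.neighborFinset p \ Ω with hT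
  have hTcard : T.card ≤ I.card * (D - Ω.card) :=
    Finset.card_biUnion_le_card_mul _ _ _ fun p hp => hNcard p (hIP hp)
  have hPΩ : ∀ p ∈ P, p ∉ Ω := fun p hp ho => H.loopless.irrefl _ (hΩ p hp p ho)
  have hPsub : P ⊆ I ∪ T := by
    intro p hp
    rw [Finset.mem_union, or_iff_not_imp_left]
    intro hpI
    by_contra hpT
    have hpadj : ∀ x ∈ I, ¬ H.Adj x p := by
      intro x hx hadj
      refine hpT (Finset.mem_biUnion.2 ⟨x, hx, ?_⟩)
      simpa [hadj] using hPΩ p hp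
    have := hmax (insert p I) (Finset.mem_filter.2 ⟨?_, ?_⟩)
    · rw [Finset.card_insert_of_notMem hpI] at this
      omega
    · rw [Finset.mem_powerset]
      exact Finset.insert_subset hp hIP
    · intro x hx y hy
      rcases Finset.mem_insert.1 hx with rfl | hx' <;> rcases Finset.mem_insert.1 hy with rfl | hy'
      · exact H.loopless.irrefl _
      · exact fun h => hpadj y hy' h.symm
      · exact hpadj x hx'
      · exact hind x hx' y hy'
  have hPcard : P.card ≤ I.card * (D - Ω.card + 1) := by
    have h1 := (Finset.card_le_card hPsub).trans (Finset.card_union_le I T)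
    rw [mul_add, mul_one]
    omega
  have hI2 : 2 ≤ I.card := by
    by_contra hcon
    have : I.card * (D - Ω.card + 1) ≤ 1 * (D - Ω.card + 1) := Nat.mul_le_mul_right _ (by omega)
    omega
  refine ⟨I.card, hPcard, ?_, hΩD⟩
  have := ht.le_of_isolated' (I := I) (S := Ω ∪ T) hI2 ?_ ?_
  · have h1 := Finset.card_union_le Ω T
    omega
  · intro x hx hxS
    rcases Finset.mem_union.1 hxS with h | h
    · exact hPΩ x (hIP hx) h
    · obtain ⟨y, hy, h⟩ := Finset.mem_biUnion.1 h
      exact hind y hy x hx (by simpa using (Finset.mem_sdiff.1 h).1)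
  · intro x hx y hxy
    by_cases hy : y ∈ Ω
    · exact Finset.mem_union_left _ hy
    · exact Finset.mem_union_right _ (Finset.mem_biUnion.2 ⟨x, hx, by simpa [hy] using hxy⟩)

/-- A nearly tough graph that satisfies the degree condition and has a spanning path between any
two non-adjacent vertices has a spanning cycle. -/
theorem hasSpanningCycle_of_degrees {t : ℕ} (ht4 : 4 ≤ t) (ht : H.NearlyTough t 1)
    (hdeg : ∀ j, 1 ≤ j → 2 * j ≤ Fintype.card α →
      j ≤ (Finset.univ.filter fun u => H.degree u < j).card →
      j ≤ (Finset.univ.filter fun u => Fintype.card α - j ≤ H.degree u).card + t)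
    (hpath : ∀ x y, x ≠ y → ¬ H.Adj x y → ∃ v, H.IsSpanningPath (Fintype.card α) v ∧ v 0 = x ∧
      v (Fintype.card α - 1) = y)
    (hne : ∃ x y, x ≠ y ∧ ¬ H.Adj x y) : H.HasSpanningCycle := by
  classical
  by_contra hH
  set N := Fintype.card α with hN
  obtain ⟨x₀, y₀, hxy₀, hadj₀⟩ := hne
  have hN2 : 2 ≤ N := by
    have := Fintype.one_lt_card_iff.2 ⟨x₀, y₀, hxy₀⟩
    omega
  set s := t / 2 with hs
  have hsum : ∀ x y, x ≠ y → ¬ H.Adj x y → H.degree x + H.degree y + s + 2 ≤ N := by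
    intro x y hxy hadj
    obtain ⟨v, hv, rfl, rfl⟩ := hpath x y hxy hadj
    have := SpanningPath.degree_add_degree_lt ht4 hv hH ht hN2
    omega
  set c : ℕ → ℕ := fun k => (Finset.univ.filter fun u => H.degree u ≤ k).card with hc
  obtain ⟨⟨x, y⟩, hxy, hmax⟩ := Finset.exists_max_image
    (Finset.univ.filter fun p : α × α => p.1 ≠ p.2 ∧ ¬ H.Adj p.1 p.2)
    (fun p => H.degree p.1 + H.degree p.2) ⟨(x₀, y₀), by simp [hxy₀, hadj₀]⟩
  simp only [Finset.mem_filter, Finset.mem_univ, true_and] at hxy hmax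
  obtain ⟨a, b, hab, hnab, hle, hmaxab⟩ : ∃ a b, a ≠ b ∧ ¬ H.Adj a b ∧ H.degree a ≤ H.degree b ∧
      ∀ u, u ≠ b → ¬ H.Adj b u → H.degree u ≤ H.degree a := by
    rcases le_total (H.degree x) (H.degree y) with h | h
    · refine ⟨x, y, hxy.1, hxy.2, h, fun u hu hu' => ?_⟩
      have := hmax (u, y) ⟨hu, fun h => hu' h.symm⟩
      dsimp only at this
      omega
    · refine ⟨y, x, hxy.1.symm, fun h => hxy.2 h.symm, h, fun u hu hu' => ?_⟩
      have := hmax (x, u) ⟨hu.symm, hu'⟩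
      dsimp only at this
      omega
  have hex : ∃ k, (∃ u, H.degree u = k) ∧ k + s + 1 ≤ c k := by
    refine ⟨H.degree a, ⟨a, rfl⟩, ?_⟩
    have h1 : N ≤ c (H.degree a) + _ + 1 := card_le_card_degree_le hmaxab
    have h2 := hsum a b hab hnab
    omega
  obtain ⟨⟨p, hp⟩, hD⟩ := Nat.find_spec hex
  have hDmin : ∀ u, H.degree u + s + 1 ≤ c (H.degree u) → Nat.find hex ≤ H.degree u :=
    fun u hu => Nat.find_min' hex ⟨⟨u, rfl⟩, hu⟩
  set D := Nat.find hex with hDdef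
  have hDN : 2 * D + s + 2 ≤ N := by
    have h0 := hDmin a (by
      have h1 : N ≤ c (H.degree a) + _ + 1 := card_le_card_degree_le hmaxab
      have h2 := hsum a b hab hnab
      omega)
    have h2 := hsum a b hab hnab
    omega
  have hDt : t * 2 ≤ D + 1 := by
    obtain ⟨u, hu, hpu⟩ := exists_nonadj_of_degree_lt (H := H) (y := p) (by omega)
    have := ht.le_degree hu.symm hpu
    omega
  set j := min (D + s + 1) (N / 2) with hj
  have hjD : D + 1 ≤ j := by omega
  set Ω := Finset.univ.filter fun u => N - j ≤ H.degree u with hΩdef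
  have hΩmem : ∀ o, o ∈ Ω ↔ N - j ≤ H.degree o := by simp [hΩdef]
  have hΩcard : j ≤ Ω.card + t := by
    refine hdeg j (by omega) (by omega) ?_
    have h1 : c D ≤ (Finset.univ.filter fun u => H.degree u < j).card := by
      refine Finset.card_le_card fun u hu => ?_
      simp only [Finset.mem_filter, Finset.mem_univ, true_and] at hu ⊢
      omega
    omega
  have hΩlow : ∀ o ∈ Ω, ∀ z, z ≠ o → ¬ H.Adj o z → H.degree z < D := by
    intro o ho z hz hadj
    have h1 := hsum o z hz.symm hadj
    have h2 := (hΩmem o).1 ho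
    omega
  have hΩuniv : ∀ o ∈ Ω, ∀ z, z ≠ o → H.Adj o z := by
    intro o ho z hz
    by_contra hadj
    obtain ⟨w, hw, hwmax⟩ := Finset.exists_max_image
      (Finset.univ.filter fun w => w ≠ o ∧ ¬ H.Adj o w) (fun w => H.degree w)
      ⟨z, by simp [hz, hadj]⟩
    simp only [Finset.mem_filter, Finset.mem_univ, true_and] at hw hwmax
    have h1 := hΩlow o ho w hw.1 hw.2
    have h2 : N ≤ c (H.degree w) + _ + 1 := card_le_card_degree_le (y := o)
      fun u hu hu' => hwmax u ⟨hu, hu'⟩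
    have h3 := hsum o w hw.1.symm hw.2
    have := hDmin w (by omega)
    omega
  rcases le_total (D + s + 1) (N / 2) with hcase | hcase
  · have hjeq : j = D + s + 1 := min_eq_left hcase
    have hΩP : ∀ q ∈ Finset.univ.filter (fun u => H.degree u ≤ D), ∀ o ∈ Ω, H.Adj q o := by
      intro q hq o ho
      simp only [Finset.mem_filter, Finset.mem_univ, true_and] at hq
      refine (hΩuniv o ho q ?_).symm
      rintro rfl
      have := (hΩmem q).1 ho
      omega
    obtain ⟨i, h1, h2, h3⟩ := tough_le_of_low_degrees (D := D) ht
      (P := Finset.univ.filter fun u => H.degree u ≤ D) hΩP (by simp)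
      (by change D + 2 ≤ c D; omega)
    have h1' : c D ≤ i * (D - Ω.card + 1) := h1
    obtain ⟨e, he⟩ : ∃ e, D = Ω.card + e := ⟨D - Ω.card, by omega⟩
    rw [he, Nat.add_sub_cancel_left] at h2
    rw [show D - Ω.card = e by omega] at h1'
    have h4 : i * (e + 1 + e) ≤ i * t := Nat.mul_le_mul_left i (by omega)
    have h5 : i * (e + 1 + e) = i * (e + 1) + i * e := by ring
    have h6 := mul_comm i t
    omega
  · have hjeq : j = N / 2 := min_eq_right hcase
    obtain ⟨v, hv, -, -⟩ := hpath x₀ y₀ hxy₀ hadj₀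
    have hk : t ≤ Ω.card := by omega
    have h1 := tough_le_of_universal hv hH ht hN2 rfl hΩuniv (Finset.card_pos.1 (by omega))
    have h2 : t * (Ω.card + 1) + Ω.card ≤ 2 * (Ω.card + t) + 1 := by
      have : 0 < t * (Ω.card + 1) := by positivity
      omega
    nlinarith

end SimpleGraph

namespace SimpleGraph

variable {α : Type*} {H : SimpleGraph α}

/-- `u` runs periodically around a cycle with `N` vertices. -/
structure IsPeriodicTour (H : SimpleGraph α) (N : ℕ) (u : ℕ → α) : Prop where
  eq_iff : ∀ i d, u (i + d) = u i ↔ N ∣ d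
  adj : ∀ i, H.Adj (u i) (u (i + 1))

lemma HasSpanningCycle.exists_isPeriodicTour [Fintype α] (h : H.HasSpanningCycle) :
    ∃ u, H.IsPeriodicTour (Fintype.card α) u := by
  classical
  obtain ⟨L, hnd, hall, hch, a, b, ha, hb, hba⟩ := h
  have hlen : L.length = Fintype.card α := by
    rw [← List.toFinset_card_of_nodup hnd, ← Finset.card_univ]
    congr 1
    ext x
    simp [hall x]
  have hpos : 0 < L.length := List.length_pos_of_mem (hall a)
  rw [← hlen]
  refine ⟨fun i => L[i % L.length]'(Nat.mod_lt _ hpos), fun i d => ?_, fun i => ?_⟩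
  · rw [hnd.getElem_inj_iff]
    constructor
    · intro h
      have h1 := (Nat.modEq_iff_dvd' (Nat.le_add_right i d)).1 (Eq.symm h)
      simpa using h1
    · rintro ⟨c, rfl⟩
      simp
  · rw [List.isChain_iff_getElem] at hch
    have hlt := Nat.mod_lt i hpos
    rcases Nat.lt_or_ge (i % L.length + 1) L.length with h1 | h1
    · have h2 : (i + 1) % L.length = i % L.length + 1 := by
        rw [← Nat.mod_eq_of_lt h1]
        simp
      simp only [h2]
      exact hch _ h1
    · have h0 : i % L.length + 1 = L.length := by omega
      have h2 : (i + 1) % L.length = 0 := by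
        rw [← Nat.mod_add_mod, h0, Nat.mod_self]
      have h3 : i % L.length = L.length - 1 := by omega
      simp only [h2, h3]
      rw [List.head?_eq_getElem?, List.getElem?_eq_some_iff] at ha
      rw [List.getLast?_eq_getElem?, List.getElem?_eq_some_iff] at hb
      obtain ⟨_, rfl⟩ := ha
      obtain ⟨_, rfl⟩ := hb
      exact hba

namespace IsPeriodicTour

variable {N : ℕ} {u : ℕ → α}

lemma injOn (hu : H.IsPeriodicTour N u) (k : ℕ) {i j : ℕ} (hi : i < N) (hj : j < N)
    (h : u (k + i) = u (k + j)) : i = j := by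
  have key : ∀ a b, a < b → b < N → u (k + a) ≠ u (k + b) := by
    intro a b hab hb h
    have h1 := (hu.eq_iff (k + a) (b - a)).1 (by
      rw [show k + a + (b - a) = k + b by omega]
      exact h.symm)
    have := Nat.le_of_dvd (by omega) h1
    omega
  rcases lt_trichotomy i j with hij | hij | hij
  · exact absurd h (key i j hij hj)
  · exact hij
  · exact absurd h.symm (key j i hij hi)

lemma exists_eq [Fintype α] (hu : H.IsPeriodicTour (Fintype.card α) u) (k : ℕ) (x : α) :
    ∃ i < Fintype.card α, u (k + i) = x := by
  have hbij : Function.Bijective (fun i : Fin (Fintype.card α) => u (k + i)) := by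
    rw [Fintype.bijective_iff_injective_and_card]
    exact ⟨fun i j h => Fin.ext (hu.injOn k i.2 j.2 h), Fintype.card_fin _⟩
  obtain ⟨i, hi⟩ := hbij.2 x
  exact ⟨i, i.2, hi⟩

lemma card_filter [Fintype α] (hu : H.IsPeriodicTour (Fintype.card α) u) (k : ℕ)
    (p : α → Prop) [DecidablePred p] :
    ((Finset.range (Fintype.card α)).filter fun i => p (u (k + i))).card =
      (Finset.univ.filter p).card := by
  refine Finset.card_bij (fun i _ => u (k + i)) ?_ ?_ ?_
  · intro i hi
    simpa using (Finset.mem_filter.1 hi).2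
  · intro i hi j hj h
    simp only [Finset.mem_filter, Finset.mem_range] at hi hj
    exact hu.injOn k hi.1 hj.1 h
  · intro x hx
    obtain ⟨i, hi, rfl⟩ := hu.exists_eq k x
    exact ⟨i, by simpa [hi] using hx, rfl⟩

end IsPeriodicTour

lemma hasSpanningCycle_top [Fintype α] (h : 2 ≤ Fintype.card α) :
    (⊤ : SimpleGraph α).HasSpanningCycle := by
  classical
  have hnd : (Finset.univ : Finset α).toList.Nodup := Finset.nodup_toList _
  have hlen : (Finset.univ : Finset α).toList.length = Fintype.card α := by simp
  refine ⟨Finset.univ.toList, hnd, by simp, ?_, (Finset.univ : Finset α).toList[0],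
    (Finset.univ : Finset α).toList[Fintype.card α - 1], ?_, ?_, ?_⟩
  · rw [List.isChain_iff_getElem]
    intro i hi
    rw [top_adj, Ne, hnd.getElem_inj_iff]
    omega
  · rw [List.head?_eq_getElem?, List.getElem?_eq_getElem]
  · rw [List.getLast?_eq_getElem?, List.getElem?_eq_getElem (by omega)]
    simp
  · rw [top_adj, Ne, hnd.getElem_inj_iff]
    omega

/-- A spanning cycle that needs the extra edge between `x` and `y` yields a spanning path. -/
lemma exists_isSpanningPath_of_sup_edge [Fintype α] (hN : 3 ≤ Fintype.card α)
    (hH : ¬ H.HasSpanningCycle) {x y : α} (h : (H ⊔ edge x y).HasSpanningCycle) :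
    ∃ v, H.IsSpanningPath (Fintype.card α) v ∧ v 0 = x ∧ v (Fintype.card α - 1) = y := by
  obtain ⟨u, hu⟩ := h.exists_isPeriodicTour
  set N := Fintype.card α with hNdef
  have hedge : ∀ i, H.Adj (u i) (u (i + 1)) ∨
      (u i = x ∧ u (i + 1) = y) ∨ (u i = y ∧ u (i + 1) = x) := by
    intro i
    have := hu.adj i
    rw [sup_adj, edge_adj] at this
    tauto
  have hpath : ∀ k, (∀ i, i + 1 < N → H.Adj (u (k + i)) (u (k + (i + 1)))) →
      H.IsSpanningPath N fun i => u (k + i) := fun k hk =>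
    ⟨fun i j hi hj h => hu.injOn k hi hj h, fun z => hu.exists_eq k z, hk⟩
  have hlast : ∀ k, u (k + 1 + (N - 1)) = u k := by
    intro k
    rw [show k + 1 + (N - 1) = k + N by omega]
    exact (hu.eq_iff k N).2 dvd_rfl
  by_cases hall : ∀ k, H.Adj (u k) (u (k + 1))
  · refine absurd ?_ hH
    have hp := hpath 1 fun i _ => hall (1 + i)
    refine hp.hasSpanningCycle (hp.up (Nat.zero_le (N - 1)) (by omega)) ?_ (by simp; omega)
      (by intro i hi; simp; omega)
    have h0 := hlast 0
    rw [zero_add] at h0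
    change H.Adj (u (1 + (N - 1))) (u 1)
    rw [h0]
    exact hall 0
  · push Not at hall
    obtain ⟨k, hk⟩ := hall
    have hkxy := (hedge k).resolve_left hk
    have hne1 : ∀ i, i + 1 < N → u (k + 1 + i) ≠ u k := by
      intro i hi h
      have h1 := (hu.eq_iff k (1 + i)).1 (by rw [← add_assoc]; exact h)
      have := Nat.le_of_dvd (by omega) h1
      omega
    have hp := hpath (k + 1) (by
      intro i hi
      refine (hedge (k + 1 + i)).resolve_right fun h => ?_
      have h1 := hne1 i hi
      have h2 : ¬ (u (k + 1 + i) = u (k + 1) ∧ u (k + 1 + i + 1) = u k) := by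
        rintro ⟨e1, e2⟩
        have : i = 0 := hu.injOn (k + 1) (by omega) (by omega) e1
        subst this
        exact hne1 1 (by omega) e2
      rcases h with ⟨e1, e2⟩ | ⟨e1, e2⟩ <;> rcases hkxy with ⟨e3, e4⟩ | ⟨e3, e4⟩
      · exact h1 (e1.trans e3.symm)
      · exact h2 ⟨e1.trans e4.symm, e2.trans e3.symm⟩
      · exact h2 ⟨e1.trans e4.symm, e2.trans e3.symm⟩
      · exact h1 (e1.trans e3.symm))
    rcases hkxy with ⟨e3, e4⟩ | ⟨e3, e4⟩
    · refine ⟨_, hp.reverse, ?_, ?_⟩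
      · simpa [e3] using hlast k
      · simpa using e4
    · exact ⟨_, hp, by simpa using e4, by simpa [e3] using hlast k⟩

/-- A graph has a spanning cycle if it is nearly tough and all its supergraphs satisfy the degree
condition. -/
theorem NearlyTough.hasSpanningCycle [Fintype α] {G : SimpleGraph α} {t : ℕ} (ht4 : 4 ≤ t)
    (hcard : 2 ≤ Fintype.card α) (ht : ∀ H, G ≤ H → H.NearlyTough t 1)
    (hdeg : ∀ (H : SimpleGraph α) [DecidableRel H.Adj], G ≤ H → ∀ j, 1 ≤ j →
      2 * j ≤ Fintype.card α → j ≤ (Finset.univ.filter fun u => H.degree u < j).card →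
      j ≤ (Finset.univ.filter fun u => Fintype.card α - j ≤ H.degree u).card + t) :
    G.HasSpanningCycle := by
  classical
  by_contra hG
  obtain ⟨H, hGH, hmax⟩ :=
    Finite.exists_le_maximal (p := fun H : SimpleGraph α => ¬ H.HasSpanningCycle) hG
  refine hmax.1 ?_
  by_cases hne : ∃ x y, x ≠ y ∧ ¬ H.Adj x y
  · have hN : 3 ≤ Fintype.card α := by
      obtain ⟨x, y, hxy, hadj⟩ := hne
      have h1 := (ht H hGH).le_degree hxy hadj
      have h2 := H.degree_lt_card_verts x
      omega
    refine hasSpanningCycle_of_degrees ht4 (ht H hGH) (hdeg H hGH) ?_ hne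
    intro x y hxy hadj
    refine exists_isSpanningPath_of_sup_edge hN hmax.1 ?_
    by_contra hcon
    have := hmax.2 hcon le_sup_left
    refine hadj (this ?_)
    rw [sup_adj, edge_adj]
    tauto
  · push Not at hne
    have : H = ⊤ := by
      ext x y
      rw [top_adj]
      exact ⟨fun h => h.ne, hne x y⟩
    rw [this]
    exact hasSpanningCycle_top hcard

/-- A path along a periodic tour. -/
lemma IsPeriodicTour.exists_isPath {V : Type*} {G : SimpleGraph V} {p : V → Prop}
    {H : SimpleGraph {x // p x}} (hHG : ∀ a b, H.Adj a b → G.Adj a.1 b.1) {N : ℕ}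
    {u : ℕ → {x // p x}} (hu : H.IsPeriodicTour N u) (i k : ℕ) (hk : k < N) :
    ∃ q : G.Walk (u i) (u (i + k)), q.IsPath ∧ q.length = k ∧
      ∀ x ∈ q.support, ∃ j ≤ k, x = u (i + j) := by
  induction k with
  | zero => exact ⟨Walk.nil, by simp, rfl, fun x hx => ⟨0, le_rfl, by simpa using hx⟩⟩
  | succ k ih =>
    obtain ⟨q, hq, hlen, hsup⟩ := ih (by omega)
    refine ⟨q.concat (hHG _ _ (hu.adj (i + k))), hq.concat ?_ _, by simp [hlen], ?_⟩
    · intro hmem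
      obtain ⟨j, hj, h⟩ := hsup _ hmem
      have := hu.injOn i (i := k + 1) (j := j) (by omega) (by omega) (Subtype.ext h)
      omega
    · intro x hx
      rw [Walk.support_concat, List.mem_append, List.mem_singleton] at hx
      rcases hx with hx | rfl
      · obtain ⟨j, hj, rfl⟩ := hsup x hx
        exact ⟨j, by omega, rfl⟩
      · exact ⟨k + 1, le_rfl, rfl⟩

/-- A vertex adjacent to more than half of a spanning cycle of the remaining vertices lies on
cycles of all lengths. -/
theorem exists_isCycle_of_hasSpanningCycle {V : Type*} [Fintype V] [DecidableEq V]
    {G : SimpleGraph V} [DecidableRel G.Adj] {w : V} (hw : Fintype.card V ≤ 2 * G.degree w)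
    {H : SimpleGraph {x // x ≠ w}} (hHG : ∀ a b, H.Adj a b → G.Adj a.1 b.1)
    (hH : H.HasSpanningCycle) {l : ℕ} (hl3 : 3 ≤ l) (hl : l ≤ Fintype.card V) :
    ∃ (a : V) (p : G.Walk a a), p.IsCycle ∧ p.length = l := by
  obtain ⟨u, hu⟩ := hH.exists_isPeriodicTour
  have hcard : Fintype.card {x // x ≠ w} = Fintype.card V - 1 := by simp
  have hdeg : (Finset.univ.filter fun x : {x // x ≠ w} => G.Adj w x).card = G.degree w := by
    rw [← card_neighborFinset_eq_degree]
    refine Finset.card_bij (fun x _ => x.1) ?_ ?_ ?_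
    · intro x hx
      simpa using hx
    · intro x _ y _ h
      exact Subtype.ext h
    · intro y hy
      rw [mem_neighborFinset] at hy
      exact ⟨⟨y, hy.ne'⟩, by simpa using hy, rfl⟩
  have h0 := hu.card_filter 0 fun x => G.Adj w x
  have hk := hu.card_filter (l - 2) fun x => G.Adj w x
  rw [hdeg] at h0 hk
  obtain ⟨i, hi⟩ : ∃ i, G.Adj w (u i) ∧ G.Adj w (u (i + (l - 2))) := by
    by_contra! hcon
    have hdisj : Disjoint
        ((Finset.range (Fintype.card {x // x ≠ w})).filter fun i => G.Adj w (u (0 + i)))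
        ((Finset.range (Fintype.card {x // x ≠ w})).filter fun i => G.Adj w (u (l - 2 + i))) := by
      refine Finset.disjoint_left.2 fun i hi hi' => ?_
      refine hcon i ?_ ?_
      · simpa using (Finset.mem_filter.1 hi).2
      · rw [add_comm]
        exact (Finset.mem_filter.1 hi').2
    have h1 := Finset.card_union_of_disjoint hdisj
    have h2 := Finset.card_le_card (Finset.union_subset
      (Finset.filter_subset (fun i => G.Adj w (u (0 + i)))
        (Finset.range (Fintype.card {x // x ≠ w})))
      (Finset.filter_subset (fun i => G.Adj w (u (l - 2 + i))) _))
    rw [Finset.card_range] at h2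
    omega
  obtain ⟨q, hq, hlen, hsup⟩ := hu.exists_isPath hHG i (l - 2) (by omega)
  have hwq : w ∉ q.support := by
    intro h
    obtain ⟨j, -, hj⟩ := hsup w h
    exact (u (i + j)).2 hj.symm
  refine ⟨w, Walk.cons hi.1 (q.concat hi.2.symm), ?_, by simp [hlen]; omega⟩
  rw [Walk.cons_isCycle_iff]
  refine ⟨hq.concat hwq _, ?_⟩
  rw [Walk.edges_concat, List.concat_eq_append, List.mem_append, List.mem_singleton]
  rintro (h | h)
  · exact hwq (q.fst_mem_support_of_mem_edges h)
  · rw [Sym2.eq_swap, Sym2.congr_left] at h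
    have h1 := (hu.eq_iff i (l - 2)).1 (Subtype.ext h.symm)
    have := Nat.le_of_dvd (by omega) h1
    omega

end SimpleGraph

namespace SimpleGraph

/-- A tough graph with the degree condition has a vertex adjacent to half of the vertices. -/
lemma exists_card_le_two_mul_degree {V : Type*} [Fintype V] {G : SimpleGraph V}
    [DecidableRel G.Adj] {n t : ℕ} (ht : 4 ≤ t) (hn : Fintype.card V = n) (hn3 : 3 ≤ n)
    (htough : G.NearlyTough t 0) {v : ℕ → V}
    (hcond : ∀ i, 1 ≤ i → 2 * i < n →
      G.degree (v i) ≤ i → n - i ≤ G.degree (v (n - i + t))) : ∃ w, n ≤ 2 * G.degree w := by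
  classical
  by_contra! hcon
  have : Nonempty V := Fintype.card_pos_iff.1 (by omega)
  obtain ⟨x⟩ := this
  obtain ⟨y, hyx, hxy⟩ := exists_nonadj_of_degree_lt (H := G) (y := x) (by
    have := hcon x
    omega)
  have h1 := htough.le_degree hyx.symm hxy
  have h2 := hcon x
  have h3 := hcon (v ((n - 1) / 2))
  have h4 := hcon (v (n - (n - 1) / 2 + t))
  have h5 := hcond ((n - 1) / 2) (by omega) (by omega) (by omega)
  omega

lemma degree_le_degree_add_one {V : Type*} [Fintype V] [DecidableEq V] {G : SimpleGraph V}
    [DecidableRel G.Adj] {w : V} {H : SimpleGraph {x // x ≠ w}} [DecidableRel H.Adj]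
    (hGH : ∀ a b : {x // x ≠ w}, G.Adj a b → H.Adj a b) (u : {x // x ≠ w}) :
    G.degree u ≤ H.degree u + 1 := by
  have hsub : G.neighborFinset u ⊆
      insert w ((H.neighborFinset u).map (Function.Embedding.subtype _)) := by
    intro x hx
    rw [mem_neighborFinset] at hx
    by_cases hxw : x = w
    · simp [hxw]
    · refine Finset.mem_insert_of_mem (Finset.mem_map.2 ⟨⟨x, hxw⟩, ?_, rfl⟩)
      rw [mem_neighborFinset]
      exact hGH u ⟨x, hxw⟩ hx
  have h1 := (Finset.card_le_card hsub).trans (Finset.card_insert_le _ _)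
  rwa [Finset.card_map, card_neighborFinset_eq_degree, card_neighborFinset_eq_degree] at h1

lemma card_degree_condition {V : Type*} [Fintype V] {G : SimpleGraph V} [DecidableRel G.Adj]
    {n t : ℕ} {v : ℕ → V} (hbij : Set.BijOn v (Set.Icc 1 n) Set.univ)
    (hmono : ∀ i j, 1 ≤ i → i ≤ j → j ≤ n → G.degree (v i) ≤ G.degree (v j))
    (hcond : ∀ i, 1 ≤ i → 2 * i < n →
      G.degree (v i) ≤ i → n - i ≤ G.degree (v (n - i + t)))
    {j : ℕ} (hj1 : 1 ≤ j) (hjn : 2 * j < n)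
    (hj : j ≤ (Finset.univ.filter fun u => G.degree u ≤ j).card) :
    j + 1 ≤ (Finset.univ.filter fun u => n - j ≤ G.degree u).card + t := by
  classical
  have hdeg : G.degree (v j) ≤ j := by
    by_contra hcon
    have hsub : (Finset.univ.filter fun u => G.degree u ≤ j) ⊆
        (Finset.Icc 1 (j - 1)).image v := by
      intro u hu
      obtain ⟨i, hi, rfl⟩ := hbij.surjOn (Set.mem_univ u)
      simp only [Finset.mem_filter, Finset.mem_univ, true_and] at hu
      refine Finset.mem_image_of_mem v (Finset.mem_Icc.2 ⟨hi.1, ?_⟩)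
      by_contra hij
      have := hmono j i hj1 (by omega) hi.2
      omega
    have h1 := (Finset.card_le_card hsub).trans Finset.card_image_le
    rw [Nat.card_Icc] at h1
    omega
  have hhigh := hcond j hj1 hjn hdeg
  rcases Nat.lt_or_ge j t with htj | htj
  · omega
  · have hsub : (Finset.Icc (n - j + t) n).image v ⊆
        Finset.univ.filter fun u => n - j ≤ G.degree u := by
      intro u hu
      obtain ⟨i, hi, rfl⟩ := Finset.mem_image.1 hu
      rw [Finset.mem_Icc] at hi
      simp only [Finset.mem_filter, Finset.mem_univ, true_and]
      exact hhigh.trans (hmono _ _ (by omega) hi.1 hi.2)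
    have h1 := Finset.card_le_card hsub
    rw [Finset.card_image_of_injOn, Nat.card_Icc] at h1
    · omega
    · intro a ha b hb hab
      simp only [Finset.coe_Icc, Set.mem_Icc] at ha hb
      exact hbij.injOn ⟨by omega, ha.2⟩ ⟨by omega, hb.2⟩ hab

end SimpleGraph

/-- A `t`-tough graph (`t ≥ 4` an integer) on `n ≥ 3` vertices whose degree
sequence `d_1 ≤ ⋯ ≤ d_n` satisfies: for all `1 ≤ i < n/2`, `d_i ≤ i` implies
`d_{n-i+t} ≥ n - i`, is pancyclic: it has a cycle of every length `ℓ` with `3 ≤ ℓ ≤ n`. -/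
theorem degree_sequence_tough_pancyclic
    {V : Type*} [Fintype V] [DecidableEq V] (G : SimpleGraph V) [DecidableRel G.Adj]
    (n t : ℕ) (ht : 4 ≤ t) (hn : Fintype.card V = n) (hn3 : 3 ≤ n)
    (htough : SimpleGraph.Tough (t : ℚ) G)
    (v : ℕ → V) (hbij : Set.BijOn v (Set.Icc 1 n) Set.univ)
    (hmono : ∀ i j, 1 ≤ i → i ≤ j → j ≤ n → G.degree (v i) ≤ G.degree (v j))
    (hcond : ∀ i, 1 ≤ i → 2 * i < n →
      G.degree (v i) ≤ i → n - i ≤ G.degree (v (n - i + t))) :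
    ∀ ℓ : ℕ, 3 ≤ ℓ → ℓ ≤ n → ∃ (a : V) (p : G.Walk a a), p.IsCycle ∧ p.length = ℓ := by
  intro l hl3 hl
  obtain ⟨w, hw⟩ := SimpleGraph.exists_card_le_two_mul_degree ht hn hn3 htough.nearlyTough hcond
  have hcard : Fintype.card {x // x ≠ w} = n - 1 := by simp [hn]
  refine SimpleGraph.exists_isCycle_of_hasSpanningCycle (by omega)
    (H := G.comap (Subtype.val : {x // x ≠ w} → V)) (fun _ _ h => h) ?_ hl3 (by omega)
  refine SimpleGraph.NearlyTough.hasSpanningCycle ht (by omega)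
    (fun H hH => htough.nearlyTough.delete_vertex fun a b h => hH h) ?_
  intro H _ hH j hj1 hjN hj
  have hdeg := SimpleGraph.degree_le_degree_add_one (G := G) (H := H) fun a b h => hH h
  rw [hcard] at hjN ⊢
  have hlow : j ≤ (Finset.univ.filter fun u => G.degree u ≤ j).card := by
    refine hj.trans ?_
    refine Finset.card_le_card_of_injOn (fun u => u.1) ?_ fun a _ b _ h => Subtype.ext h
    intro u hu
    have h1 : H.degree u < j := by simpa using hu
    have h2 := hdeg u
    simp only [Finset.coe_filter, Finset.mem_univ, true_and, Set.mem_ofPred_eq]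
    omega
  have hhigh := SimpleGraph.card_degree_condition hbij hmono hcond hj1 (by omega) hlow
  have hsub : (Finset.univ.filter fun u => n - j ≤ G.degree u) ⊆ insert w
      ((Finset.univ.filter fun u => n - 1 - j ≤ H.degree u).map
        (Function.Embedding.subtype _)) := by
    intro u hu
    by_cases huw : u = w
    · simp [huw]
    · refine Finset.mem_insert_of_mem (Finset.mem_map.2 ⟨⟨u, huw⟩, ?_, rfl⟩)
      simp only [Finset.mem_filter, Finset.mem_univ, true_and] at hu ⊢
      have := hdeg ⟨u, huw⟩
      dsimp only at this
      omega
  have h1 := (Finset.card_le_card hsub).trans (Finset.card_insert_le _ _)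
  rw [Finset.card_map] at h1
  omega
end
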